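/- arXiv:2309.17263 — 13 statements merged into one kernel-verified Lean document; each statement's English description precedes it below -/
import Mathlib

section
/- If a classical deterministic strategy (E1,E2,D) satisfies the zero conditions, i.e. D(E1(x),E2(y)) ≠ ¬(x⊕y) for all x,y ∈ {0,1}², then both encodings are balanced partitions: the preimage E1⁻¹({0}) has exactly 2 elements and the preimage E2⁻¹({0}) has exactly 2 elements. -/
/-- Bitwise XOR of two-bit strings. -/
def xor2 (x y : Bool × Bool) : Bool × Bool := (xor x.1 y.1, xor x.2 y.2)

/-- Bitwise complement of a two-bit string. -/
def compl2 (s : Bool × Bool) : Bool × Bool := (!s.1, !s.2)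

theorem compl2_xor2_compl2_xor2 (x s : Bool × Bool) : compl2 (xor2 x (compl2 (xor2 x s))) = s := by
  revert x s
  decide

theorem injective_compl2_xor2 (s : Bool × Bool) :
    Function.Injective fun x => compl2 (xor2 x s) := by
  revert s
  unfold Function.Injective
  decide

/-- If `compl2 (xor2 x y)` misses a value on `A × B`, then `A` and `B` have at most four elements
in total. -/
theorem card_add_card_le_four_of_compl2_xor2_ne {A B : Finset (Bool × Bool)} {s : Bool × Bool}
    (h : ∀ x ∈ A, ∀ y ∈ B, s ≠ compl2 (xor2 x y)) : A.card + B.card ≤ 4 := by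
  have hdisj : Disjoint (A.image fun x => compl2 (xor2 x s)) B := by
    rw [Finset.disjoint_left]
    intro y hy hyB
    obtain ⟨x, hx, rfl⟩ := Finset.mem_image.mp hy
    exact h x hx _ hyB (compl2_xor2_compl2_xor2 x s).symm
  calc A.card + B.card = ((A.image fun x => compl2 (xor2 x s)) ∪ B).card := by
        rw [Finset.card_union_of_disjoint hdisj,
          Finset.card_image_of_injective _ (injective_compl2_xor2 s)]
    _ ≤ Fintype.card (Bool × Bool) := Finset.card_le_univ _
    _ = 4 := rfl

theorem card_fiber_false_add_card_fiber_true (E : Bool × Bool → Bool) :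
    (Finset.univ.filter fun s => E s = false).card +
      (Finset.univ.filter fun s => E s = true).card = 4 := by
  simpa using Finset.card_filter_add_card_filter_not (s := Finset.univ) fun s => E s = false

theorem zero_conditions_force_balanced_encodings
    (E1 E2 : Bool × Bool → Bool) (D : Bool × Bool → Bool × Bool)
    (hzero : ∀ x y : Bool × Bool, D (E1 x, E2 y) ≠ compl2 (xor2 x y)) :
    (Finset.univ.filter fun s : Bool × Bool => E1 s = false).card = 2 ∧
    (Finset.univ.filter fun s : Bool × Bool => E2 s = false).card = 2 := by
  have key (i j : Bool) : (Finset.univ.filter fun s => E1 s = i).card +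
      (Finset.univ.filter fun s => E2 s = j).card ≤ 4 := by
    refine card_add_card_le_four_of_compl2_xor2_ne (s := D (i, j)) fun x hx y hy => ?_
    rw [← (Finset.mem_filter.mp hx).2, ← (Finset.mem_filter.mp hy).2]
    exact hzero x y
  have h1 := card_fiber_false_add_card_fiber_true E1
  have h2 := card_fiber_false_add_card_fiber_true E2
  have hff := key false false
  have hft := key false true
  have htf := key true false
  have htt := key true true
  omega
end

section
/- Define e¹,e²,e³ : {0,1}² → {0,1} by e¹(s₁s₂)=s₁, e²(s₁s₂)=s₂, e³(s₁s₂)=s₁⊕s₂. If u,v ∈ {1,2,3} with u ≠ v, then there exists no decoding function D : {0,1}×{0,1} → {0,1}² such that the deterministic strategy (eᵘ, eᵛ, D) satisfies the zero conditions D(eᵘ(x),eᵛ(y)) ≠ ¬(x⊕y) for all x,y ∈ {0,1}². -/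
/-- The three balanced encodings `e¹, e², e³` (indexed by `1, 2, 3`):
`e¹` sends the first bit, `e²` the second bit, `e³` the parity. -/
def enc : Fin 3 → (Bool × Bool → Bool)
  | 0 => fun s => s.1
  | 1 => fun s => s.2
  | 2 => fun s => xor s.1 s.2

/-- For distinct balanced encodings, every output `d` is forbidden for some pair of inputs
that produces the messages `false, false`. -/
theorem exists_forbidden_output_of_ne :
    ∀ u v : Fin 3, u ≠ v → ∀ d : Bool × Bool, ∃ x y : Bool × Bool,
      enc u x = false ∧ enc v y = false ∧ d = compl2 (xor2 x y) := by
  decide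

theorem no_decoding_for_mixed_encodings (u v : Fin 3) (huv : u ≠ v) :
    ¬ ∃ D : Bool × Bool → Bool × Bool,
        ∀ x y : Bool × Bool, D (enc u x, enc v y) ≠ compl2 (xor2 x y) := by
  rintro ⟨D, hD⟩
  obtain ⟨x, y, hx, hy, hd⟩ := exists_forbidden_output_of_ne u v huv (D (false, false))
  exact hD x y (by rw [hx, hy, hd])
end

section
/- For every pair of deterministic encodings E1,E2 : {0,1}² → {0,1} and every probability distribution q on the finite set of decoding functions D : {0,1}×{0,1} → {0,1}², the induced channel p(a|x,y) = Σ_D q(D)·[a = D(E1(x),E2(y))] is not equal to N_PBR. In other words, fixed deterministic encodings combined with locally randomized decoding cannot simulate N_PBR. -/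
/-- The PBR multiple access channel. -/
noncomputable def NPBR (a x y : Bool × Bool) : ℝ :=
  if a = xor2 x y then 1 / 2
  else if a = compl2 (xor2 x y) then 0
  else 1 / 4

/-- Distinct inputs to the first sender induce distinct output distributions of `NPBR`. -/
theorem NPBR_ne_of_ne {x x' : Bool × Bool} (hx : x ≠ x') (y : Bool × Bool) :
    NPBR (xor2 x y) x y ≠ NPBR (xor2 x y) x' y := by
  have hxor : xor2 x y ≠ xor2 x' y := by
    revert x x' y
    decide
  unfold NPBR
  rw [if_pos rfl, if_neg hxor]
  split_ifs <;> norm_num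

/-- Fixed deterministic encodings with locally randomized decoding cannot
simulate `NPBR`. -/
theorem no_fixed_encoding_random_decoding_simulation
    (E1 E2 : Bool × Bool → Bool)
    (q : (Bool × Bool → Bool × Bool) → ℝ)
    (hq0 : ∀ D, 0 ≤ q D) (hq1 : ∑ D, q D = 1) :
    ¬ ∀ a x y : Bool × Bool,
        (∑ D, q D * (if a = D (E1 x, E2 y) then 1 else 0)) = NPBR a x y := by
  intro h
  obtain ⟨x, x', hx, hE⟩ := Fintype.exists_ne_map_eq_of_card_lt E1 (by decide)
  apply NPBR_ne_of_ne hx (false, false)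
  rw [← h, ← h, hE]
end

section
/- The MAC N_PBR cannot be simulated with 1-bit communication from each sender assisted by independent sender–receiver shared randomness: for all finite types Λ₁, Λ₂, all probability mass functions q₁ on Λ₁ and q₂ on Λ₂, all families of encodings E1 : Λ₁ → ({0,1}² → {0,1}) and E2 : Λ₂ → ({0,1}² → {0,1}), and all families of decodings D : Λ₁ × Λ₂ → ({0,1}×{0,1} → {0,1}²), the channel p(a|x,y) = Σ_{λ₁,λ₂} q₁(λ₁) q₂(λ₂)·[a = D(λ₁,λ₂)(E1(λ₁)(x), E2(λ₂)(y))] is not equal to N_PBR. -/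
/-- Two one-bit encodings are compatible if, for every pair of messages, some output is never
excluded by `NPBR` for the inputs producing these messages. -/
def Compatible (f g : Bool × Bool → Bool) : Prop :=
  ∀ s t : Bool, ∃ a, ∀ x y, f x = s → g y = t → a ≠ compl2 (xor2 x y)

/-- The encoding with the given truth table. -/
def tableEncoding (p q r s : Bool) (x : Bool × Bool) : Bool :=
  bif x.1 then bif x.2 then s else r else bif x.2 then q else p

theorem eq_tableEncoding (f : Bool × Bool → Bool) :
    f = tableEncoding (f (false, false)) (f (false, true)) (f (true, false)) (f (true, true)) := by
  funext ⟨a, b⟩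
  cases a <;> cases b <;> rfl

theorem exists_shift_tableEncoding :
    ∀ p q r s : Bool, ∃ d, d ≠ (false, false) ∧ ∀ p' q' r' s' : Bool,
      (∀ m n : Bool, ∃ a, ∀ x y, tableEncoding p' q' r' s' x = m →
        tableEncoding p q r s y = n → a ≠ compl2 (xor2 x y)) →
      tableEncoding p' q' r' s' d = tableEncoding p' q' r' s' (false, false) := by
  decide +kernel

/-- All encodings compatible with `g` identify the input `00` with one common other input. -/
theorem exists_shift_of_compatible (g : Bool × Bool → Bool) :
    ∃ d, d ≠ (false, false) ∧ ∀ f, Compatible f g → f d = f (false, false) := by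
  obtain ⟨d, hd, h⟩ := exists_shift_tableEncoding
    (g (false, false)) (g (false, true)) (g (true, false)) (g (true, true))
  refine ⟨d, hd, fun f hf => ?_⟩
  rw [eq_tableEncoding g] at hf
  rw [eq_tableEncoding f] at hf ⊢
  exact h _ _ _ _ hf

theorem NPBR_compl2 (x y : Bool × Bool) : NPBR (compl2 (xor2 x y)) x y = 0 := by
  have h : compl2 (xor2 x y) ≠ xor2 x y := by
    simp [compl2, Prod.ext_iff]
  simp [NPBR, h]

theorem NPBR_shift_ne {d : Bool × Bool} (hd : d ≠ (false, false)) :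
    NPBR (false, false) d (false, false) ≠ NPBR (false, false) (false, false) (false, false) := by
  rcases d with ⟨a, b⟩
  cases a <;> cases b <;> first | exact absurd rfl hd | norm_num [NPBR, xor2, compl2]

/-- `NPBR` cannot be simulated with 1-bit communication from each sender
assisted by independent sender–receiver shared randomness. -/
theorem no_independent_SR_simulation_of_NPBR
    (Λ₁ Λ₂ : Type) [Fintype Λ₁] [Fintype Λ₂]
    (q₁ : Λ₁ → ℝ) (q₂ : Λ₂ → ℝ)
    (hq₁0 : ∀ l, 0 ≤ q₁ l) (hq₁1 : ∑ l, q₁ l = 1)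
    (hq₂0 : ∀ l, 0 ≤ q₂ l) (hq₂1 : ∑ l, q₂ l = 1)
    (E1 : Λ₁ → (Bool × Bool → Bool)) (E2 : Λ₂ → (Bool × Bool → Bool))
    (D : Λ₁ × Λ₂ → (Bool × Bool → Bool × Bool)) :
    ¬ ∀ a x y : Bool × Bool,
        (∑ l₁, ∑ l₂, q₁ l₁ * q₂ l₂ *
          (if a = D (l₁, l₂) (E1 l₁ x, E2 l₂ y) then 1 else 0)) = NPBR a x y := by
  intro h
  obtain ⟨l₂, -, hl₂⟩ : ∃ l ∈ Finset.univ, 0 < q₂ l :=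
    Finset.exists_lt_of_sum_lt (f := fun _ => (0 : ℝ)) (by simp [hq₂1])
  have compat (l₁ : Λ₁) (hl₁ : 0 < q₁ l₁) : Compatible (E1 l₁) (E2 l₂) := by
    rintro s t
    refine ⟨D (l₁, l₂) (s, t), ?_⟩
    rintro x y rfl rfl hD
    have hterm (i : Λ₁) (j : Λ₂) : 0 ≤ q₁ i * q₂ j *
        (if compl2 (xor2 x y) = D (i, j) (E1 i x, E2 j y) then (1 : ℝ) else 0) :=
      mul_nonneg (mul_nonneg (hq₁0 i) (hq₂0 j)) (by split_ifs <;> norm_num)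
    have hsum := h (compl2 (xor2 x y)) x y
    rw [NPBR_compl2, Finset.sum_eq_zero_iff_of_nonneg
      (fun i _ => Finset.sum_nonneg fun j _ => hterm i j)] at hsum
    have hrow := hsum l₁ (Finset.mem_univ _)
    rw [Finset.sum_eq_zero_iff_of_nonneg (fun j _ => hterm l₁ j)] at hrow
    have hzero := hrow l₂ (Finset.mem_univ _)
    rw [if_pos hD.symm, mul_one] at hzero
    exact (mul_pos hl₁ hl₂).ne' hzero
  obtain ⟨d, hd, hshift⟩ := exists_shift_of_compatible (E2 l₂)
  apply NPBR_shift_ne hd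
  rw [← h, ← h]
  refine Finset.sum_congr rfl fun l₁ _ => ?_
  rcases (hq₁0 l₁).eq_or_lt with h0 | hpos
  · simp [← h0]
  · rw [hshift _ (compat l₁ hpos)]
end

section
/- The MAC N_PBR can be simulated with 1-bit communication from each sender assisted by globally shared classical randomness: there exists a probability mass function q on the finite set of triples (E1,E2,D), with E1,E2 : {0,1}² → {0,1} and D : {0,1}×{0,1} → {0,1}², such that for all a,x,y ∈ {0,1}², Σ_{(E1,E2,D)} q(E1,E2,D)·[a = D(E1(x),E2(y))] = N_PBR(a|x,y). -/
/-- A classical deterministic strategy: two 1-bit encodings and a decoding. -/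
abbrev Strategy : Type :=
  (Bool × Bool → Bool) × (Bool × Bool → Bool) × (Bool × Bool → Bool × Bool)

/-- Both senders transmit the same bit of their input, selected by `k.1`; the receiver outputs the
XOR in that position and the shared random bit `k.2` in the other one. -/
def bitStrategy (k : Bool × Bool) : Strategy :=
  (fun x => cond k.1 x.1 x.2, fun y => cond k.1 y.1 y.2,
    fun m => cond k.1 (xor m.1 m.2, k.2) (k.2, xor m.1 m.2))

/-- Integrating against the pushforward of a weight `c` along `s`. -/
theorem sum_pushforward_mul {ι α : Type*} [Fintype ι] [Fintype α] [DecidableEq α]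
    (s : ι → α) (c : ι → ℝ) (f : α → ℝ) :
    ∑ t, (∑ k, if t = s k then c k else 0) * f t = ∑ k, c k * f (s k) := by
  simp_rw [Finset.sum_mul, ite_mul, zero_mul]
  rw [Finset.sum_comm]
  simp

/-- `NPBR` can be simulated with 1-bit channels assisted by globally shared
classical randomness. -/
theorem global_SR_simulation_of_NPBR :
    ∃ q : Strategy → ℝ,
      (∀ t, 0 ≤ q t) ∧ (∑ t, q t = 1) ∧
      ∀ a x y : Bool × Bool,
        (∑ t, q t * (if a = t.2.2 (t.1 x, t.2.1 y) then 1 else 0)) = NPBR a x y := by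
  refine ⟨fun t => ∑ k, if t = bitStrategy k then 1 / 4 else 0, fun t => ?_, ?_, fun a x y => ?_⟩
  · exact Finset.sum_nonneg fun k _ => by split_ifs <;> norm_num
  · have h := sum_pushforward_mul bitStrategy (fun _ => 1 / 4) (fun _ => 1)
    simp only [mul_one] at h
    rw [h]
    norm_num
  · rw [sum_pushforward_mul bitStrategy (fun _ => 1 / 4)
      (fun t => if a = t.2.2 (t.1 x, t.2.1 y) then 1 else 0)]
    obtain ⟨a₁, a₂⟩ := a
    obtain ⟨x₁, x₂⟩ := x
    obtain ⟨y₁, y₂⟩ := y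
    cases a₁ <;> cases a₂ <;> cases x₁ <;> cases x₂ <;> cases y₁ <;> cases y₂ <;>
      norm_num [Fintype.sum_prod_type, bitStrategy, NPBR, xor2, compl2]
end

section
/- Let w₅(x,y) = c_{(y−x) mod 5} for x,y ∈ {0,…,4}, where (c₀,c₁,c₂,c₃,c₄) = (0,1,−3,−5,3). Then: (i) for all deterministic strategies E1,E2 : {0,…,4} → {0,1} and D : {0,1}×{0,1} → {0,1}, the payoff Σ_{(x,y) : D(E1(x),E2(y))=0} w₅(x,y) ≤ 4; (ii) Σ_{x,y} w₅(x,y)·(1/4)(1 + cos(2π(x−y)/5)) = 15(√5−1)/4; and (iii) 15(√5−1)/4 > 4. -/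
noncomputable section

/-- Witness coefficients for the pentagon MAC. -/
def c5 : Fin 5 → ℤ := ![0, 1, -3, -5, 3]

/-- The witness `w₅(x,y) = c_{(y−x) mod 5}`. -/
def w5 (x y : Fin 5) : ℤ := c5 (y - x)

/-- For a fixed encoding of the first sender, even the best response of the second sender to the
decoding rules `h₀` and `h₁` attached to the two messages has payoff at most `4`. -/
lemma sum_max_w5_le (E : Fin 5 → Bool) (h₀ h₁ : Bool → Bool) :
    ∑ y, max (∑ x, if h₀ (E x) = false then w5 x y else 0)
      (∑ x, if h₁ (E x) = false then w5 x y else 0) ≤ 4 := by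
  revert E h₀ h₁
  decide +kernel

lemma classical_payoff_le (E1 E2 : Fin 5 → Bool) (D : Bool × Bool → Bool) :
    ∑ p ∈ Finset.univ.filter
      (fun p : Fin 5 × Fin 5 => D (E1 p.1, E2 p.2) = false), w5 p.1 p.2 ≤ 4 := by
  rw [Finset.sum_filter, Fintype.sum_prod_type_right]
  refine le_trans (Finset.sum_le_sum fun y _ => ?_)
    (sum_max_w5_le E1 (fun a => D (a, false)) (fun a => D (a, true)))
  cases h : E2 y <;> simp only [h, le_max_left, le_max_right]

lemma cos_two_pi_div_five : Real.cos (2 * Real.pi / 5) = (√5 - 1) / 4 := by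
  have h5 : √5 ^ 2 = 5 := Real.sq_sqrt (by norm_num)
  rw [mul_div_assoc, Real.cos_two_mul, Real.cos_pi_div_five]
  linear_combination h5 / 8

lemma cos_four_pi_div_five : Real.cos (4 * Real.pi / 5) = -(1 + √5) / 4 := by
  rw [show 4 * Real.pi / 5 = Real.pi - Real.pi / 5 by ring, Real.cos_pi_sub,
    Real.cos_pi_div_five]
  ring

lemma cos_six_pi_div_five : Real.cos (6 * Real.pi / 5) = -(1 + √5) / 4 := by
  rw [show 6 * Real.pi / 5 = Real.pi / 5 + Real.pi by ring, Real.cos_add_pi,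
    Real.cos_pi_div_five]
  ring

lemma cos_eight_pi_div_five : Real.cos (8 * Real.pi / 5) = (√5 - 1) / 4 := by
  rw [show 8 * Real.pi / 5 = 2 * Real.pi - 2 * Real.pi / 5 by ring, Real.cos_two_pi_sub,
    cos_two_pi_div_five]

/-- The polygon angle depends only on the cyclic difference of the inputs. -/
lemma cos_pentagon_angle (x k : Fin 5) :
    Real.cos (2 * Real.pi * (((x : ℕ) : ℝ) - (((x + k : Fin 5) : ℕ) : ℝ)) / 5) =
      Real.cos (2 * (k : ℕ) * Real.pi / 5) := by
  rw [Fin.val_add]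
  have h := congrArg (Nat.cast (R := ℝ)) (Nat.mod_add_div ((x : ℕ) + (k : ℕ)) 5)
  push_cast at h
  rw [← Real.cos_neg, ← Real.cos_add_nat_mul_two_pi _ (((x : ℕ) + (k : ℕ)) / 5)]
  congr 1
  linear_combination (2 * Real.pi / 5) * h

lemma quantum_payoff_eq :
    ∑ x : Fin 5, ∑ y : Fin 5, (w5 x y : ℝ) *
        ((1 / 4) * (1 + Real.cos (2 * Real.pi * (((x : ℕ) : ℝ) - ((y : ℕ) : ℝ)) / 5)))
      = 15 * (√5 - 1) / 4 := by
  have hrow (x : Fin 5) : ∑ y : Fin 5, (w5 x y : ℝ) *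
        ((1 / 4) * (1 + Real.cos (2 * Real.pi * (((x : ℕ) : ℝ) - ((y : ℕ) : ℝ)) / 5)))
      = 3 * (√5 - 1) / 4 := by
    rw [← Equiv.sum_comp (Equiv.addLeft x)]
    simp only [Equiv.coe_addLeft, cos_pentagon_angle, w5, add_sub_cancel_left]
    simp only [Fin.sum_univ_five, c5, Matrix.cons_val]
    norm_num [cos_two_pi_div_five, cos_four_pi_div_five, cos_six_pi_div_five,
      cos_eight_pi_div_five]
    ring
  simp only [hrow, Finset.sum_const, Finset.card_univ, Fintype.card_fin, nsmul_eq_mul]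
  push_cast
  ring

theorem pentagon_witness :
    (∀ (E1 E2 : Fin 5 → Bool) (D : Bool × Bool → Bool),
      (∑ p ∈ Finset.univ.filter
          (fun p : Fin 5 × Fin 5 => D (E1 p.1, E2 p.2) = false), w5 p.1 p.2) ≤ 4) ∧
    (∑ x : Fin 5, ∑ y : Fin 5, (w5 x y : ℝ) *
        ((1 / 4) * (1 + Real.cos (2 * Real.pi * (((x : ℕ) : ℝ) - ((y : ℕ) : ℝ)) / 5)))
      = 15 * (Real.sqrt 5 - 1) / 4) ∧
    15 * (Real.sqrt 5 - 1) / 4 > 4 := by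
  refine ⟨classical_payoff_le, quantum_payoff_eq, ?_⟩
  have h : (31 / 15 : ℝ) < √5 := Real.lt_sqrt_of_sq_lt (by norm_num)
  linarith
end
end

section
/- Let w₆ be the 6×6 integer matrix with rows (indexed by x=0,…,5, columns y=0,…,5): row 0 = (0,4,−4,−4,−5,2), row 1 = (2,0,4,−4,−4,−2), row 2 = (−5,2,0,4,−7,−10), row 3 = (−4,−5,2,0,4,−4), row 4 = (−4,−4,−2,2,0,4), row 5 = (4,−7,−4,−5,2,0). Then: (i) for all deterministic strategies E1,E2 : {0,…,5} → {0,1} and D : {0,1}×{0,1} → {0,1}, the payoff Σ_{(x,y) : D(E1(x),E2(y))=0} w₆(x,y) ≤ 6; (ii) Σ_{x,y} w₆(x,y)·(1/4)(1 + cos(2π(x−y)/6)) = 27/4; and (iii) 27/4 > 6. -/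
noncomputable section

/-- The witness matrix `w₆` for the hexagon MAC. -/
def w6 : Matrix (Fin 6) (Fin 6) ℤ :=
  !![0, 4, -4, -4, -5, 2;
     2, 0, 4, -4, -4, -2;
     -5, 2, 0, 4, -7, -10;
     -4, -5, 2, 0, 4, -4;
     -4, -4, -2, 2, 0, 4;
     4, -7, -4, -5, 2, 0]

/-- The payoff collected in column `y` of `w6` from the rows on which `s` is `false`. -/
def columnPayoff (s : Fin 6 → Bool) (y : Fin 6) : ℤ :=
  ∑ x, if s x = false then w6 x y else 0

/-- Against a fixed first encoder and decoder, the best second encoder maximizes columnwise. -/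
theorem sum_max_columnPayoff_le (E : Fin 6 → Bool) (f g : Bool → Bool) :
    ∑ y, max (columnPayoff (f ∘ E) y) (columnPayoff (g ∘ E) y) ≤ 6 := by
  revert E f g
  decide +kernel

theorem deterministic_payoff_le (E1 E2 : Fin 6 → Bool) (D : Bool × Bool → Bool) :
    (∑ p ∈ Finset.univ.filter
        (fun p : Fin 6 × Fin 6 => D (E1 p.1, E2 p.2) = false), w6 p.1 p.2) ≤ 6 := by
  rw [Finset.sum_filter, Fintype.sum_prod_type_right]
  refine le_trans (Finset.sum_le_sum fun y _ => ?_)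
    (sum_max_columnPayoff_le E1 (fun a => D (a, false)) (fun a => D (a, true)))
  obtain hy | hy := Bool.eq_false_or_eq_true (E2 y) <;> simp only [hy]
  · exact le_max_right (columnPayoff _ y) (columnPayoff (_ ∘ E1) y)
  · exact le_max_left (columnPayoff (_ ∘ E1) y) (columnPayoff _ y)

/-- Twice the cosine of the angle between two hexagon vertices whose indices differ by `k`. -/
def twiceHexagonCos : Fin 6 → ℤ :=
  ![2, 1, -1, -2, -1, 1]

theorem cos_hexagon_natCast (k : Fin 6) :
    Real.cos (2 * Real.pi * ((k : ℕ) : ℝ) / 6) = (twiceHexagonCos k : ℝ) / 2 := by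
  have h1 : Real.cos (2 * Real.pi * 1 / 6) = 1 / 2 := by
    rw [← Real.cos_pi_div_three]; congr 1; ring
  have h2 : Real.cos (2 * Real.pi * 2 / 6) = -1 / 2 := by
    rw [show 2 * Real.pi * 2 / 6 = Real.pi - Real.pi / 3 by ring, Real.cos_pi_sub,
      Real.cos_pi_div_three]
    norm_num
  have h3 : Real.cos (2 * Real.pi * 3 / 6) = -1 := by
    rw [← Real.cos_pi]; congr 1; ring
  have h4 : Real.cos (2 * Real.pi * 4 / 6) = -1 / 2 := by
    rw [← h2, ← Real.cos_two_pi_sub]; congr 1; ring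
  have h5 : Real.cos (2 * Real.pi * 5 / 6) = 1 / 2 := by
    rw [← h1, ← Real.cos_two_pi_sub]; congr 1; ring
  rw [mul_one] at h1
  fin_cases k <;> simp [twiceHexagonCos, h1, h2, h3, h4, h5]

theorem cos_hexagon_sub (x y : Fin 6) :
    Real.cos (2 * Real.pi * (((x : ℕ) : ℝ) - ((y : ℕ) : ℝ)) / 6) =
      (twiceHexagonCos (x - y) : ℝ) / 2 := by
  rw [← cos_hexagon_natCast]
  rcases le_or_gt y x with h | h
  · rw [Fin.sub_val_of_le h, Nat.cast_sub h]
  · have hval : ((x - y : Fin 6) : ℕ) + y = 6 + x := by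
      rw [Fin.val_sub]; omega
    have hcast : (((x - y : Fin 6) : ℕ) : ℝ) = 6 + x - y := by
      rw [eq_sub_iff_add_eq]; exact_mod_cast hval
    rw [hcast, ← Real.cos_add_two_pi]
    congr 1
    ring

theorem hexagon_witness :
    (∀ (E1 E2 : Fin 6 → Bool) (D : Bool × Bool → Bool),
      (∑ p ∈ Finset.univ.filter
          (fun p : Fin 6 × Fin 6 => D (E1 p.1, E2 p.2) = false), w6 p.1 p.2) ≤ 6) ∧
    (∑ x : Fin 6, ∑ y : Fin 6, (w6 x y : ℝ) *
        ((1 / 4) * (1 + Real.cos (2 * Real.pi * (((x : ℕ) : ℝ) - ((y : ℕ) : ℝ)) / 6)))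
      = 27 / 4) ∧
    (27 : ℝ) / 4 > 6 := by
  refine ⟨deterministic_payoff_le, ?_, by norm_num⟩
  have hsum : ∑ x, ∑ y, w6 x y * (2 + twiceHexagonCos (x - y)) = 54 := by
    decide +kernel
  calc _ = 1 / 8 * ((∑ x, ∑ y, w6 x y * (2 + twiceHexagonCos (x - y)) : ℤ) : ℝ) := by
        push_cast
        simp only [Finset.mul_sum, cos_hexagon_sub]
        refine Finset.sum_congr rfl fun x _ => Finset.sum_congr rfl fun y _ => ?_
        ring
    _ = 27 / 4 := by rw [hsum]; norm_num
end
end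

section
/- Let w₇(x,y) = c_{(y−x) mod 7} for x,y ∈ {0,…,6}, where (c₀,…,c₆) = (0,1,−1,−1,−1,−1,1). Then: (i) for all deterministic strategies E1,E2 : {0,…,6} → {0,1} and D : {0,1}×{0,1} → {0,1}, the payoff Σ_{(x,y) : D(E1(x),E2(y))=0} w₇(x,y) ≤ 2; (ii) Σ_{x,y} w₇(x,y)·(1/4)(1 + cos(2π(x−y)/7)) = (7/2)(−1 + cos(π/7) + sin(π/14) + sin(3π/14)); and (iii) (7/2)(−1 + cos(π/7) + sin(π/14) + sin(3π/14)) > 2. -/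
noncomputable section

/-- Witness coefficients for the heptagon MAC. -/
def c7 : Fin 7 → ℤ := ![0, 1, -1, -1, -1, -1, 1]

/-- The witness `w₇(x,y) = c_{(y−x) mod 7}`. -/
def w7 (x y : Fin 7) : ℤ := c7 (y - x)

/-- The total weight in column `y` of the inputs `x` with `S x = true`. -/
def columnWeight (S : Fin 7 → Bool) (y : Fin 7) : ℤ :=
  ∑ x : Fin 7, bif S x then w7 x y else 0

theorem columnWeight_not (S : Fin 7 → Bool) (y : Fin 7) :
    columnWeight (fun x => !S x) y = -2 - columnWeight S y := by
  have hcol : ∑ x : Fin 7, w7 x y = -2 := by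
    revert y
    decide
  rw [eq_sub_iff_add_eq, ← hcol, columnWeight, columnWeight, ← Finset.sum_add_distrib]
  refine Finset.sum_congr rfl fun x _ => ?_
  cases S x <;> simp

theorem sum_columnWeight_le (S : Fin 7 → Bool) :
    ∑ y : Fin 7, (columnWeight S y).toNat ≤ 2 ∧
      ∑ y : Fin 7, (columnWeight S y + 1).natAbs ≤ 9 := by
  simp only [columnWeight, Fin.sum_univ_seven, w7, Fin.isValue, Fin.reduceSub,
    show c7 0 = 0 from rfl, show c7 1 = 1 from rfl, show c7 2 = -1 from rfl,
    show c7 3 = -1 from rfl, show c7 4 = -1 from rfl, show c7 5 = -1 from rfl,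
    show c7 6 = 1 from rfl]
  generalize S 0 = s0, S 1 = s1, S 2 = s2, S 3 = s3, S 4 = s4, S 5 = s5, S 6 = s6
  clear S
  revert s0 s1 s2 s3 s4 s5 s6
  decide +kernel

theorem payoff_le_two (E1 E2 : Fin 7 → Bool) (D : Bool × Bool → Bool) :
    ∑ p ∈ Finset.univ.filter (fun p : Fin 7 × Fin 7 => D (E1 p.1, E2 p.2) = false),
      w7 p.1 p.2 ≤ 2 := by
  rw [Finset.sum_filter, Fintype.sum_prod_type, Finset.sum_comm]
  have hcol (y : Fin 7) (b : Bool) : ∑ x, (if D (E1 x, b) = false then w7 x y else 0) =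
      (bif D (false, b) then 0 else -2 - columnWeight E1 y) +
        (bif D (true, b) then 0 else columnWeight E1 y) := by
    rw [← columnWeight_not]
    cases h0 : D (false, b) <;> cases h1 : D (true, b) <;>
      simp only [cond_true, cond_false, columnWeight, zero_add, add_zero,
        ← Finset.sum_add_distrib] <;>
      first
      | refine Finset.sum_congr rfl fun x _ => ?_
        cases hx : E1 x <;> simp [h0, h1]
      | refine Finset.sum_eq_zero fun x _ => ?_
        cases hx : E1 x <;> simp [h0, h1]
  obtain ⟨hpos, habs⟩ := sum_columnWeight_le E1
  have hneg := (sum_columnWeight_le fun x => !E1 x).1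
  simp only [columnWeight_not] at hneg
  have hpos' : ∑ y, ((columnWeight E1 y).toNat : ℤ) ≤ 2 := by exact_mod_cast hpos
  have hneg' : ∑ y, ((-2 - columnWeight E1 y).toNat : ℤ) ≤ 2 := by exact_mod_cast hneg
  have habs' : ∑ y, (((columnWeight E1 y + 1).natAbs : ℤ) - 1) ≤ 2 := by
    have h : ∑ y, ((columnWeight E1 y + 1).natAbs : ℤ) ≤ 9 := by
      rw [← Nat.cast_sum]
      exact Int.ofNat_le.2 habs
    rw [Finset.sum_sub_distrib]
    simpa using h
  have hbound {g : Fin 7 → ℤ} (hg : ∑ y, g y ≤ 2)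
      (h : ∀ y b, (bif D (false, b) then 0 else -2 - columnWeight E1 y) +
        (bif D (true, b) then 0 else columnWeight E1 y) ≤ g y) :
      ∑ y, ∑ x, (if D (E1 x, E2 y) = false then w7 x y else 0) ≤ 2 :=
    (Finset.sum_le_sum fun y _ => (hcol y (E2 y)).trans_le (h y (E2 y))).trans hg
  cases h00 : D (false, false) <;> cases h01 : D (false, true) <;>
    cases h10 : D (true, false) <;> cases h11 : D (true, true) <;>
    first
    | refine hbound hpos' fun y b => ?_
      cases b <;> simp only [h00, h01, h10, h11, cond] <;> omega
    | refine hbound hneg' fun y b => ?_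
      cases b <;> simp only [h00, h01, h10, h11, cond] <;> omega
    | refine hbound habs' fun y b => ?_
      cases b <;> simp only [h00, h01, h10, h11, cond] <;> omega

theorem cos_two_pi_mul_sub_div_seven (x y : Fin 7) :
    Real.cos (2 * Real.pi * (((x : ℕ) : ℝ) - ((y : ℕ) : ℝ)) / 7) =
      Real.cos (2 * Real.pi * ((y - x : Fin 7) : ℕ) / 7) := by
  rw [← Real.cos_neg]
  rcases le_or_gt x y with h | h
  · rw [Fin.sub_val_of_le h, Nat.cast_sub h]
    ring_nf
  · rw [Fin.coe_sub_iff_lt.2 h, Nat.cast_sub (by lia), ← Real.cos_add_two_pi]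
    push_cast
    ring_nf

theorem cos_six_pi_div_seven : Real.cos (6 * Real.pi / 7) = -Real.cos (Real.pi / 7) := by
  rw [← Real.cos_pi_sub]
  ring_nf

theorem cos_four_pi_div_seven : Real.cos (4 * Real.pi / 7) = -Real.sin (Real.pi / 14) := by
  rw [← Real.cos_add_pi_div_two]
  ring_nf

theorem cos_two_pi_div_seven : Real.cos (2 * Real.pi / 7) = Real.sin (3 * Real.pi / 14) := by
  rw [← Real.cos_pi_div_two_sub]
  ring_nf

theorem sum_w7_mul_polygon :
    ∑ x : Fin 7, ∑ y : Fin 7, (w7 x y : ℝ) *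
        ((1 / 4) * (1 + Real.cos (2 * Real.pi * (((x : ℕ) : ℝ) - ((y : ℕ) : ℝ)) / 7)))
      = (7 / 2) * (-1 + Real.cos (Real.pi / 7) + Real.sin (Real.pi / 14)
          + Real.sin (3 * Real.pi / 14)) := by
  have hrow (x : Fin 7) : ∑ y : Fin 7, (w7 x y : ℝ) *
        ((1 / 4) * (1 + Real.cos (2 * Real.pi * (((x : ℕ) : ℝ) - ((y : ℕ) : ℝ)) / 7)))
      = ∑ z : Fin 7, (c7 z : ℝ) * ((1 / 4) * (1 + Real.cos (2 * Real.pi * (z : ℕ) / 7))) := by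
    simp only [cos_two_pi_mul_sub_div_seven, w7]
    exact (Equiv.subRight x).sum_comp
      fun z => (c7 z : ℝ) * ((1 / 4) * (1 + Real.cos (2 * Real.pi * (z : ℕ) / 7)))
  have h1 : Real.cos (2 * Real.pi * 1 / 7) = Real.sin (3 * Real.pi / 14) := by
    rw [← cos_two_pi_div_seven, mul_one]
  have h2 : Real.cos (2 * Real.pi * 2 / 7) = -Real.sin (Real.pi / 14) := by
    rw [← cos_four_pi_div_seven]
    ring_nf
  have h3 : Real.cos (2 * Real.pi * 3 / 7) = -Real.cos (Real.pi / 7) := by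
    rw [← cos_six_pi_div_seven]
    ring_nf
  have hrefl (t : ℝ) : Real.cos (2 * Real.pi * (7 - t) / 7) = Real.cos (2 * Real.pi * t / 7) := by
    rw [← Real.cos_two_pi_sub]
    ring_nf
  have h4 := hrefl 3
  have h5 := hrefl 2
  have h6 := hrefl 1
  norm_num only at h4 h5 h6
  simp only [hrow, Finset.sum_const, Finset.card_univ, Fintype.card_fin, nsmul_eq_mul,
    Fin.sum_univ_seven, show c7 0 = 0 from rfl, show c7 1 = 1 from rfl, show c7 2 = -1 from rfl,
    show c7 3 = -1 from rfl, show c7 4 = -1 from rfl, show c7 5 = -1 from rfl,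
    show c7 6 = 1 from rfl, Fin.coe_ofNat_eq_mod]
  norm_num only [h1, h2, h3, h4, h5, h6, Nat.cast_ofNat, Nat.cast_one]
  ring

theorem two_lt_polygon_value :
    2 < (7 / 2 : ℝ) * (-1 + Real.cos (Real.pi / 7) + Real.sin (Real.pi / 14)
          + Real.sin (3 * Real.pi / 14)) := by
  have hsin : Real.sin (Real.pi / 14) =
      4 * Real.cos (Real.pi / 7) ^ 3 - 3 * Real.cos (Real.pi / 7) := by
    rw [← Real.cos_three_mul, ← Real.cos_pi_div_two_sub]
    ring_nf
  have hsin' : Real.sin (3 * Real.pi / 14) = 2 * Real.cos (Real.pi / 7) ^ 2 - 1 := by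
    rw [← Real.cos_two_mul, ← cos_two_pi_div_seven]
    ring_nf
  have hc : 0.89 < Real.cos (Real.pi / 7) := by
    nlinarith [Real.one_sub_sq_div_two_le_cos (x := Real.pi / 7), Real.pi_lt_d2, Real.pi_pos]
  rw [hsin, hsin']
  generalize Real.cos (Real.pi / 7) = c at hc
  nlinarith [pow_lt_pow_left₀ hc (by norm_num) (two_ne_zero),
    pow_lt_pow_left₀ hc (by norm_num) (three_ne_zero), mul_pos (sub_pos.2 hc) (sub_pos.2 hc)]

theorem heptagon_witness :
    (∀ (E1 E2 : Fin 7 → Bool) (D : Bool × Bool → Bool),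
      (∑ p ∈ Finset.univ.filter
          (fun p : Fin 7 × Fin 7 => D (E1 p.1, E2 p.2) = false), w7 p.1 p.2) ≤ 2) ∧
    (∑ x : Fin 7, ∑ y : Fin 7, (w7 x y : ℝ) *
        ((1 / 4) * (1 + Real.cos (2 * Real.pi * (((x : ℕ) : ℝ) - ((y : ℕ) : ℝ)) / 7)))
      = (7 / 2) * (-1 + Real.cos (Real.pi / 7) + Real.sin (Real.pi / 14)
          + Real.sin (3 * Real.pi / 14))) ∧
    (7 / 2 : ℝ) * (-1 + Real.cos (Real.pi / 7) + Real.sin (Real.pi / 14)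
          + Real.sin (3 * Real.pi / 14)) > 2 :=
  ⟨payoff_le_two, sum_w7_mul_polygon, two_lt_polygon_value⟩
end
end

section
/- For each m ∈ {5,6,7,8,9}, the polygon MAC of order m cannot be simulated by 1-bit communication from each sender even with unlimited globally shared classical randomness: there is no probability mass function q on the finite set of triples (E1,E2,D), with E1,E2 : {0,…,m−1} → {0,1} and D : {0,1}×{0,1} → {0,1}, such that for all x,y, Σ_{(E1,E2,D)} q(E1,E2,D)·[D(E1(x),E2(y)) = 0] = (1/4)(1 + cos(2π(x−y)/m)). -/
section

open Real

/-- Total weight in column `y` of the rows selected by `a`, for the circulant weights `w (x - y)`. -/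
def columnSum {m : ℕ} (w : Fin m → ℤ) (a : Fin m → Bool) (y : Fin m) : ℤ :=
  ∑ x, if a x then w (x - y) else 0

/-- `C` bounds the score of the circulant weights `w` over all deterministic one-bit strategies:
for a fixed first encoder `a`, each column is scored by the better of its two possible responses. -/
def IsClassicalBound {m : ℕ} (w : Fin m → ℤ) (C : ℤ) : Prop :=
  ∀ a : Fin m → Bool,
    ∑ y, max (columnSum w (fun _ => false) y) (columnSum w a y) ≤ C ∧
    ∑ y, max (columnSum w (fun _ => true) y) (columnSum w a y) ≤ C ∧
    ∑ y, max (columnSum w a y) (columnSum w (fun x => !a x) y) ≤ C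

theorem columnSum_false {m : ℕ} (w : Fin m → ℤ) (y : Fin m) :
    columnSum w (fun _ => false) y = 0 := by
  simp [columnSum]

theorem columnSum_true {m : ℕ} (w : Fin m → ℤ) (y : Fin m) :
    columnSum w (fun _ => true) y = ∑ d, w d := by
  have : NeZero m := ⟨y.pos.ne'⟩
  simpa [columnSum] using (Equiv.subRight y).sum_comp w

theorem columnSum_not {m : ℕ} (w : Fin m → ℤ) (a : Fin m → Bool) (y : Fin m) :
    columnSum w (fun x => !a x) y = ∑ d, w d - columnSum w a y := by
  rw [← columnSum_true w y, eq_sub_iff_add_eq]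
  simp only [columnSum, ← Finset.sum_add_distrib]
  exact Finset.sum_congr rfl fun x _ => by by_cases h : a x <;> simp [h]

/-- `P` holds for `acc` plus the entrywise sum of any subfamily of `rows`. -/
def ForallSubfamilySums (P : List ℤ → Prop) : (n : ℕ) → (Fin n → List ℤ) → List ℤ → Prop
  | 0, _, acc => P acc
  | n + 1, rows, acc =>
    ForallSubfamilySums P n (fun i => rows i.succ) acc ∧
      ForallSubfamilySums P n (fun i => rows i.succ) (List.zipWith (· + ·) acc (rows 0))

instance ForallSubfamilySums.decidable (P : List ℤ → Prop) [DecidablePred P] :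
    (n : ℕ) → (rows : Fin n → List ℤ) → DecidablePred (ForallSubfamilySums P n rows)
  | 0, _ => fun acc => inferInstanceAs (Decidable (P acc))
  | n + 1, rows => fun _ =>
    have := ForallSubfamilySums.decidable P n (fun i => rows i.succ)
    inferInstanceAs (Decidable (_ ∧ _))

theorem ForallSubfamilySums.apply {P : List ℤ → Prop} {m n : ℕ} {r : Fin n → Fin m → ℤ}
    {f : Fin m → ℤ} (h : ForallSubfamilySums P n (fun i => List.ofFn (r i)) (List.ofFn f))
    (a : Fin n → Bool) : P (List.ofFn fun y => f y + ∑ x, if a x then r x y else 0) := by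
  induction n generalizing f with
  | zero => simpa [ForallSubfamilySums] using h
  | succ n ih =>
    have hadd : List.zipWith (· + ·) (List.ofFn f) (List.ofFn (r 0)) =
        List.ofFn fun y => f y + r 0 y := by
      apply List.ext_getElem <;> simp
    simp only [ForallSubfamilySums, hadd] at h
    simp only [Fin.sum_univ_succ]
    cases h0 : a 0
    · simpa using ih h.1 fun i => a i.succ
    · simpa [add_assoc] using ih h.2 fun i => a i.succ

/-- The three inequalities of `IsClassicalBound`, for the list `l` of column sums and the total
weight `T`. -/
def ColumnSumsBounded (T C : ℤ) (l : List ℤ) : Prop :=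
  (l.map fun s => max 0 s).sum ≤ C ∧ (l.map fun s => max T s).sum ≤ C ∧
    (l.map fun s => max s (T - s)).sum ≤ C

instance (T C : ℤ) : DecidablePred (ColumnSumsBounded T C) := fun _ =>
  inferInstanceAs (Decidable (_ ∧ _))

theorem isClassicalBound_of_forallSubfamilySums {m : ℕ} {w : Fin m → ℤ} {T C : ℤ}
    (hT : ∑ d, w d = T)
    (h : ForallSubfamilySums (ColumnSumsBounded T C) m (fun x => List.ofFn fun y => w (x - y))
      (List.ofFn fun _ : Fin m => 0)) :
    IsClassicalBound w C := by
  intro a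
  have := h.apply a
  simpa [ColumnSumsBounded, List.map_ofFn, List.sum_ofFn, columnSum_false, columnSum_true,
    columnSum_not, hT, ← columnSum.eq_1] using this

theorem IsClassicalBound.sum_max_le {m : ℕ} {w : Fin m → ℤ} {C : ℤ} (h : IsClassicalBound w C)
    (a : Fin m → Bool) (f g : Bool → Bool) :
    ∑ y, max (columnSum w (fun x => f (a x)) y) (columnSum w (fun x => g (a x)) y) ≤ C := by
  obtain ⟨T, hT⟩ : ∃ T : (Fin m → Bool) → (Fin m → Bool) → ℤ,
      ∀ b c, T b c = ∑ y, max (columnSum w b y) (columnSum w c y) := ⟨_, fun _ _ => rfl⟩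
  simp only [IsClassicalBound, ← hT] at h ⊢
  have hcomm (b c) : T b c = T c b := by simp only [hT, max_comm]
  have hself (b) : T b b ≤ C := by
    refine le_trans ?_ (h b).1
    simp only [hT, max_self]
    exact Finset.sum_le_sum fun _ _ => le_max_right _ _
  have key (f : Bool → Bool) : (∀ b, f b = false) ∨ (∀ b, f b = true) ∨ (∀ b, f b = b) ∨
      (∀ b, f b = !b) := by revert f; decide
  have ha := h a
  have hb := h fun x => !a x
  have hc := h fun _ => true
  rcases key f with hf | hf | hf | hf <;> rcases key g with hg | hg | hg | hg <;>
    simp only [hf, hg] <;>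
    first
    | exact hself _
    | exact ha.1
    | exact ha.2.1
    | exact ha.2.2
    | exact hb.1
    | exact hb.2.1
    | exact hc.1
    | (rw [hcomm]; first
        | exact ha.1
        | exact ha.2.1
        | exact ha.2.2
        | exact hb.1
        | exact hb.2.1
        | exact hc.1)

theorem IsClassicalBound.sum_strategy_le {m : ℕ} {w : Fin m → ℤ} {C : ℤ}
    (h : IsClassicalBound w C) (a b : Fin m → Bool) (D : Bool × Bool → Bool) :
    ∑ x, ∑ y, w (x - y) * (if D (a x, b y) = false then 1 else 0) ≤ C := by
  rw [Finset.sum_comm]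
  refine le_trans (Finset.sum_le_sum fun y _ => ?_)
    (h.sum_max_le a (fun s => !D (s, false)) (fun s => !D (s, true)))
  cases hb : b y
  · exact le_trans (by simp [columnSum]) (le_max_left _ _)
  · exact le_trans (by simp [columnSum]) (le_max_right _ _)

theorem sum_sum_sub {m : ℕ} (F : Fin m → ℝ) :
    ∑ x : Fin m, ∑ y : Fin m, F (x - y) = m * ∑ d, F d := by
  have h (x : Fin m) : ∑ y, F (x - y) = ∑ d, F d := by
    have : NeZero m := ⟨x.pos.ne'⟩
    exact (Equiv.subLeft x).sum_comp F
  simp [h]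

/-- The polygon MAC of order `m` scores more than `C` on the circulant weights `w`. -/
def Violates (m : ℕ) (w : Fin m → ℤ) (C : ℤ) : Prop :=
  (C : ℝ) < m * ∑ d : Fin m, (w d : ℝ) * (1 / 4 * (1 + cos (2 * π * ((d : ℕ) : ℝ) / m)))

theorem cos_sub_eq {m : ℕ} (x y : Fin m) :
    cos (2 * π * (((x : ℕ) : ℝ) - ((y : ℕ) : ℝ)) / m) =
      cos (2 * π * (((x - y : Fin m) : ℕ) : ℝ) / m) := by
  have hm : (m : ℝ) ≠ 0 := by have := x.pos; positivity
  rcases le_total y x with h | h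
  · rw [Fin.sub_val_of_le h, Nat.cast_sub (by exact_mod_cast h)]
  · rcases h.eq_or_lt with rfl | h
    · rw [Fin.sub_val_of_le le_rfl, Nat.cast_sub le_rfl]
    · rw [Fin.coe_sub_iff_lt.mpr h, Nat.cast_sub (by omega), ← Real.cos_add_two_pi]
      congr 1
      push_cast
      field_simp
      ring

theorem not_simulable_of_violates {m : ℕ} {w : Fin m → ℤ} {C : ℤ} (hC : IsClassicalBound w C)
    (hV : Violates m w C) :
    ¬ ∃ q : ((Fin m → Bool) × (Fin m → Bool) × (Bool × Bool → Bool)) → ℝ,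
        (∀ t, 0 ≤ q t) ∧ (∑ t, q t = 1) ∧
        ∀ x y : Fin m,
          (∑ t, q t * (if t.2.2 (t.1 x, t.2.1 y) = false then 1 else 0)) =
            (1 / 4) * (1 + Real.cos (2 * Real.pi * (((x : ℕ) : ℝ) - ((y : ℕ) : ℝ)) / m)) := by
  rintro ⟨q, hq, hq1, h⟩
  refine hV.not_ge ?_
  rw [← sum_sum_sub]
  simp_rw [← cos_sub_eq, ← h, Finset.mul_sum]
  calc ∑ x, ∑ y, ∑ t, (w (x - y) : ℝ) *
          (q t * (if t.2.2 (t.1 x, t.2.1 y) = false then 1 else 0))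
      = ∑ t, q t * ((∑ x, ∑ y, w (x - y) *
          (if t.2.2 (t.1 x, t.2.1 y) = false then 1 else 0) : ℤ) : ℝ) := by
        simp_rw [Finset.sum_comm (s := Finset.univ (α := Fin m))
          (t := Finset.univ (α := (Fin m → Bool) × (Fin m → Bool) × (Bool × Bool → Bool)))]
        refine Finset.sum_congr rfl fun t _ => ?_
        push_cast
        simp_rw [Finset.mul_sum]
        exact Finset.sum_congr rfl fun x _ => Finset.sum_congr rfl fun y _ => by ring
    _ ≤ ∑ t, q t * (C : ℝ) := by
        gcongr with t
        · exact hq t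
        · exact hC.sum_strategy_le t.1 t.2.1 t.2.2
    _ = C := by rw [← Finset.sum_mul, hq1, one_mul]

theorem pentagon_isClassicalBound : IsClassicalBound ![0, 1, -2, -2, 1] 2 :=
  isClassicalBound_of_forallSubfamilySums (T := -2) (by decide) (by decide +kernel)

theorem hexagon_isClassicalBound : IsClassicalBound ![0, 4, -6, -7, -6, 4] 8 :=
  isClassicalBound_of_forallSubfamilySums (T := -11) (by decide) (by decide +kernel)

theorem heptagon_isClassicalBound : IsClassicalBound ![0, 1, -1, -1, -1, -1, 1] 2 :=
  isClassicalBound_of_forallSubfamilySums (T := -2) (by decide) (by decide +kernel)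

theorem octagon_isClassicalBound : IsClassicalBound ![0, 1, 0, -2, 0, -2, 0, 1] 4 :=
  isClassicalBound_of_forallSubfamilySums (T := -2) (by decide) (by decide +kernel)

theorem nonagon_isClassicalBound : IsClassicalBound ![0, 1, 1, -2, -3, -3, -2, 1, 1] 6 :=
  isClassicalBound_of_forallSubfamilySums (T := -6) (by decide) (by decide +kernel)

theorem one_sub_lt_cos_two_pi_div {m : ℕ} (hm : 0 < m) :
    1 - 2 * 3.1416 ^ 2 / (m : ℝ) ^ 2 < cos (2 * π / m) := by
  have hm' : (0 : ℝ) < m := by exact_mod_cast hm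
  have h : π ^ 2 < 3.1416 ^ 2 := by
    gcongr
    exact pi_lt_d4
  have h' : π ^ 2 / (m : ℝ) ^ 2 < 3.1416 ^ 2 / (m : ℝ) ^ 2 := by gcongr
  have := one_sub_sq_div_two_le_cos (x := 2 * π / m)
  have e : (2 * π / m) ^ 2 / 2 = 2 * (π ^ 2 / (m : ℝ) ^ 2) := by field_simp
  rw [e] at this
  rw [mul_div_assoc]
  linarith

theorem cos_reflect {m k l : ℝ} (hm : m ≠ 0) (h : k + l = m) :
    cos (2 * π * k / m) = cos (2 * π * l / m) := by
  rw [← cos_two_pi_sub]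
  congr 1
  rw [← h] at hm ⊢
  field_simp
  ring

theorem cos_double (m k l : ℝ) (h : l = 2 * k) :
    cos (2 * π * l / m) = 2 * cos (2 * π * k / m) ^ 2 - 1 := by
  rw [← cos_two_mul, h]
  congr 1
  ring

theorem cos_triple (m k l : ℝ) (h : l = 3 * k) :
    cos (2 * π * l / m) = 4 * cos (2 * π * k / m) ^ 3 - 3 * cos (2 * π * k / m) := by
  rw [← cos_three_mul, h]
  congr 1
  ring

theorem pentagon_violates : Violates 5 ![0, 1, -2, -2, 1] 2 := by
  have h3 : cos (2 * π * 3 / 5) = cos (2 * π * 2 / 5) := cos_reflect (by norm_num) (by norm_num)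
  have h4 : cos (2 * π * 4 / 5) = cos (2 * π / 5) := by
    simpa using cos_reflect (m := 5) (k := 4) (l := 1) (by norm_num) (by norm_num)
  have e2 : cos (2 * π * 2 / 5) = -((1 + √5) / 4) := by
    rw [← cos_pi_div_five, ← cos_pi_sub]; congr 1; ring
  have e1 : cos (2 * π / 5) = 2 * ((1 + √5) / 4) ^ 2 - 1 := by
    rw [← cos_pi_div_five, ← cos_two_mul]; congr 1; ring
  have hs : √5 ^ 2 = 5 := sq_sqrt (by norm_num)
  have hl : 2.2 < √5 := lt_sqrt_of_sq_lt (by norm_num)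
  simp only [Violates, Fin.sum_univ_five]
  simp [h3, h4, e1, e2]
  nlinarith

theorem hexagon_violates : Violates 6 ![0, 4, -6, -7, -6, 4] 8 := by
  have e1 : cos (2 * π / 6) = 1 / 2 := by
    rw [← cos_pi_div_three]; congr 1; ring
  have e2 : cos (2 * π * 2 / 6) = -(1 / 2) := by
    rw [cos_double 6 1 2 (by norm_num), mul_one, e1]; norm_num
  have e3 : cos (2 * π * 3 / 6) = -1 := by
    rw [← cos_pi]; congr 1; ring
  have h4 : cos (2 * π * 4 / 6) = cos (2 * π * 2 / 6) := cos_reflect (by norm_num) (by norm_num)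
  have h5 : cos (2 * π * 5 / 6) = cos (2 * π / 6) := by
    simpa using cos_reflect (m := 6) (k := 5) (l := 1) (by norm_num) (by norm_num)
  simp only [Violates, Fin.sum_univ_six]
  simp [h4, h5, e1, e2, e3]
  norm_num

theorem heptagon_violates : Violates 7 ![0, 1, -1, -1, -1, -1, 1] 2 := by
  have h4 : cos (2 * π * 4 / 7) = cos (2 * π * 3 / 7) := cos_reflect (by norm_num) (by norm_num)
  have h5 : cos (2 * π * 5 / 7) = cos (2 * π * 2 / 7) := cos_reflect (by norm_num) (by norm_num)
  have h6 : cos (2 * π * 6 / 7) = cos (2 * π / 7) := by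
    simpa using cos_reflect (m := 7) (k := 6) (l := 1) (by norm_num) (by norm_num)
  have e2 := cos_double 7 1 2 (by norm_num)
  have e3 := cos_triple 7 1 3 (by norm_num)
  have e4 := cos_double 7 2 4 (by norm_num)
  have hl := one_sub_lt_cos_two_pi_div (m := 7) (by norm_num)
  have hu : cos (2 * π / 7) < 1 := by
    rw [← cos_zero]
    exact cos_lt_cos_of_nonneg_of_le_pi le_rfl (by linarith [pi_pos]) (by positivity)
  rw [mul_one] at e2 e3
  rw [h4, e3, e2] at e4
  simp only [Violates, Fin.sum_univ_seven]
  simp [h4, h5, h6, e2, e3]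
  norm_num at hl
  generalize cos (2 * π / 7) = c at *
  have hc : 8 * c ^ 3 + 4 * c ^ 2 - 4 * c - 1 = 0 := by
    have : (c - 1) * (8 * c ^ 3 + 4 * c ^ 2 - 4 * c - 1) = 0 := by linear_combination -e4
    exact (mul_eq_zero.mp this).resolve_left (by linarith)
  linarith

theorem octagon_violates : Violates 8 ![0, 1, 0, -2, 0, -2, 0, 1] 4 := by
  have e3 : cos (2 * π * 3 / 8) = -cos (2 * π / 8) := by
    rw [← cos_pi_sub]; congr 1; ring
  have h5 : cos (2 * π * 5 / 8) = cos (2 * π * 3 / 8) := cos_reflect (by norm_num) (by norm_num)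
  have h7 : cos (2 * π * 7 / 8) = cos (2 * π / 8) := by
    simpa using cos_reflect (m := 8) (k := 7) (l := 1) (by norm_num) (by norm_num)
  have hl := one_sub_lt_cos_two_pi_div (m := 8) (by norm_num)
  simp only [Violates, Fin.sum_univ_eight]
  simp [h5, h7, e3]
  norm_num at hl
  linarith

theorem nonagon_violates : Violates 9 ![0, 1, 1, -2, -3, -3, -2, 1, 1] 6 := by
  have h5 : cos (2 * π * 5 / 9) = cos (2 * π * 4 / 9) := cos_reflect (by norm_num) (by norm_num)
  have h6 : cos (2 * π * 6 / 9) = cos (2 * π * 3 / 9) := cos_reflect (by norm_num) (by norm_num)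
  have h7 : cos (2 * π * 7 / 9) = cos (2 * π * 2 / 9) := cos_reflect (by norm_num) (by norm_num)
  have h8 : cos (2 * π * 8 / 9) = cos (2 * π / 9) := by
    simpa using cos_reflect (m := 9) (k := 8) (l := 1) (by norm_num) (by norm_num)
  have e2 := cos_double 9 1 2 (by norm_num)
  have e3 := cos_triple 9 1 3 (by norm_num)
  have e4 := cos_double 9 2 4 (by norm_num)
  have e3' : cos (2 * π * 3 / 9) = -(1 / 2) := by
    rw [← cos_pi_div_three, ← cos_pi_sub]; congr 1; ring
  have hl := one_sub_lt_cos_two_pi_div (m := 9) (by norm_num)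
  rw [mul_one] at e2 e3
  rw [e2] at e4
  rw [e3'] at e3
  simp only [Violates, Fin.sum_univ_succ]
  simp
  norm_num [h5, h6, h7, h8, e2, e3', e4] at hl ⊢
  generalize cos (2 * π / 9) = c at *
  have hc : (2 * c ^ 2 - 1) ^ 2 * 2 - 1 = - c - (2 * c ^ 2 - 1) := by
    linear_combination (-2 * c) * e3
  nlinarith

end

/-- For each `m ∈ {5,…,9}`, the polygon MAC of order `m` cannot be simulated
by 1-bit communication from each sender, even with unlimited globally shared
classical randomness. -/
theorem polygon_MAC_not_classically_simulable
    (m : ℕ) (hm5 : 5 ≤ m) (hm9 : m ≤ 9) :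
    ¬ ∃ q : ((Fin m → Bool) × (Fin m → Bool) × (Bool × Bool → Bool)) → ℝ,
        (∀ t, 0 ≤ q t) ∧ (∑ t, q t = 1) ∧
        ∀ x y : Fin m,
          (∑ t, q t * (if t.2.2 (t.1 x, t.2.1 y) = false then 1 else 0)) =
            (1 / 4) * (1 + Real.cos (2 * Real.pi * (((x : ℕ) : ℝ) - ((y : ℕ) : ℝ)) / m)) := by
  interval_cases m
  · exact not_simulable_of_violates pentagon_isClassicalBound pentagon_violates
  · exact not_simulable_of_violates hexagon_isClassicalBound hexagon_violates
  · exact not_simulable_of_violates heptagon_isClassicalBound heptagon_violates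
  · exact not_simulable_of_violates octagon_isClassicalBound octagon_violates
  · exact not_simulable_of_violates nonagon_isClassicalBound nonagon_violates
end

section
/- For each two-bit string s = s₁s₂ ∈ {0,1}² let ψ_s = (1/2)(I + ((−1)^{s₁}/√2)σ_Z + ((−1)^{s₂}/√2)σ_X) be a qubit density matrix, and let the SHIFT basis of (ℂ²)^{⊗3} be labeled by three-bit strings: φ_{000}=|000⟩, φ_{001}=|01−⟩, φ_{010}=|1−0⟩, φ_{011}=|+01⟩, φ_{100}=|−01⟩, φ_{101}=|1+0⟩, φ_{110}=|01+⟩, φ_{111}=|111⟩. Then for all a ∈ {0,1}³ and all x,y,z ∈ {0,1}², Tr[|φ_a⟩⟨φ_a| (ψ_x ⊗ ψ_y ⊗ ψ_z)] = ζ₊^{η(a;x,y,z)} ζ₋^{3−η(a;x,y,z)}. -/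
open Matrix Kronecker

noncomputable section

/-- Outer product `|v⟩⟨v|`. -/
def outer {α : Type*} (v : α → ℂ) : Matrix α α ℂ :=
  Matrix.of fun i j => v i * star (v j)

/-- Pauli `σ_Z`. -/
def sigmaZ : Matrix (Fin 2) (Fin 2) ℂ := !![1, 0; 0, -1]

/-- Pauli `σ_X`. -/
def sigmaX : Matrix (Fin 2) (Fin 2) ℂ := !![0, 1; 1, 0]

/-- `(−1)^b` for a bit `b`. -/
def sign (b : Bool) : ℝ := if b then -1 else 1

/-- The encoding state `ψ_s = (1/2)(I + ((−1)^{s₁}/√2)σ_Z + ((−1)^{s₂}/√2)σ_X)`. -/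
def psi (s : Bool × Bool) : Matrix (Fin 2) (Fin 2) ℂ :=
  (1 / 2 : ℂ) • (1 + ((sign s.1 / Real.sqrt 2 : ℝ) : ℂ) • sigmaZ
    + ((sign s.2 / Real.sqrt 2 : ℝ) : ℂ) • sigmaX)

def ket0 : Fin 2 → ℂ := ![1, 0]
def ket1 : Fin 2 → ℂ := ![0, 1]
def ketP : Fin 2 → ℂ := ![(Real.sqrt 2 : ℂ)⁻¹, (Real.sqrt 2 : ℂ)⁻¹]
def ketM : Fin 2 → ℂ := ![(Real.sqrt 2 : ℂ)⁻¹, -(Real.sqrt 2 : ℂ)⁻¹]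

/-- Tensor (Kronecker) product of three qubit vectors, indexed compatibly with
`(A ⊗ₖ B) ⊗ₖ C`. -/
def tens3 (u v w : Fin 2 → ℂ) : (Fin 2 × Fin 2) × Fin 2 → ℂ :=
  fun p => u p.1.1 * v p.1.2 * w p.2

/-- The SHIFT basis of `(ℂ²)^{⊗3}`, labeled by three-bit strings. -/
def shift : Bool × Bool × Bool → ((Fin 2 × Fin 2) × Fin 2 → ℂ)
  | (false, false, false) => tens3 ket0 ket0 ket0
  | (false, false, true)  => tens3 ket0 ket1 ketM
  | (false, true, false)  => tens3 ket1 ketM ket0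
  | (false, true, true)   => tens3 ketP ket0 ket1
  | (true, false, false)  => tens3 ketM ket0 ket1
  | (true, false, true)   => tens3 ket1 ketP ket0
  | (true, true, false)   => tens3 ket0 ket1 ketP
  | (true, true, true)    => tens3 ket1 ket1 ket1

/-- Indicator of a decidable proposition. -/
def ind (p : Prop) [Decidable p] : ℕ := if p then 1 else 0

/-- The exponent `η(a; x, y, z)` of the SHIFT MAC. -/
def eta (a : Bool × Bool × Bool) (x y z : Bool × Bool) : ℕ :=
  if a.1 = a.2.1 ∧ a.2.1 = a.2.2 then
    ind (x.1 = a.1) + ind (y.1 = a.2.1) + ind (z.1 = a.2.2)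
  else if a.1 = a.2.1 then
    ind (x.1 = false) + ind (y.1 = true) + ind (z.2 = a.2.2)
  else if a.2.2 = a.1 then
    ind (x.1 = true) + ind (y.2 = a.2.1) + ind (z.1 = false)
  else
    ind (x.2 = a.1) + ind (y.1 = false) + ind (z.1 = true)

def zetaP : ℝ := (1 + (Real.sqrt 2)⁻¹) / 2
def zetaM : ℝ := (1 - (Real.sqrt 2)⁻¹) / 2

theorem outer_tens3 (u v w : Fin 2 → ℂ) :
    outer (tens3 u v w) = (outer u ⊗ₖ outer v) ⊗ₖ outer w := by
  ext i j
  simp only [outer, tens3, Matrix.of_apply, Matrix.kroneckerMap_apply, star_mul']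
  ring

theorem trace_outer_tens3_mul (u v w : Fin 2 → ℂ) (A B C : Matrix (Fin 2) (Fin 2) ℂ) :
    (outer (tens3 u v w) * ((A ⊗ₖ B) ⊗ₖ C)).trace =
      (outer u * A).trace * (outer v * B).trace * (outer w * C).trace := by
  rw [outer_tens3, ← Matrix.mul_kronecker_mul, ← Matrix.mul_kronecker_mul,
    Matrix.trace_kronecker, Matrix.trace_kronecker]

/-- The probability of a single-qubit outcome, according to whether it matches the encoded bit. -/
def zeta (p : Prop) [Decidable p] : ℝ := if p then zetaP else zetaM

theorem zeta_mul_zeta_mul_zeta (p q r : Prop) [Decidable p] [Decidable q] [Decidable r] :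
    zeta p * zeta q * zeta r =
      zetaP ^ (ind p + ind q + ind r) * zetaM ^ (3 - (ind p + ind q + ind r)) := by
  by_cases p <;> by_cases q <;> by_cases r <;>
    simp [zeta, ind, *, -mul_eq_mul_left_iff, -mul_eq_mul_right_iff] <;> ring

theorem ofReal_sqrt_two_inv_mul_self :
    (Real.sqrt 2 : ℂ)⁻¹ * (Real.sqrt 2 : ℂ)⁻¹ = 1 / 2 := by
  rw [← mul_inv, ← Complex.ofReal_mul, Real.mul_self_sqrt zero_le_two]
  norm_num

theorem trace_outer_ket0_mul_psi (s : Bool × Bool) :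
    (outer ket0 * psi s).trace = zeta (s.1 = false) := by
  obtain ⟨_ | _, t⟩ := s <;>
    simp [outer, ket0, psi, sigmaZ, sigmaX, sign, zeta, zetaP, zetaM, Matrix.trace_fin_two,
      Matrix.mul_apply, Fin.sum_univ_two] <;> ring

theorem trace_outer_ket1_mul_psi (s : Bool × Bool) :
    (outer ket1 * psi s).trace = zeta (s.1 = true) := by
  obtain ⟨_ | _, t⟩ := s <;>
    simp [outer, ket1, psi, sigmaZ, sigmaX, sign, zeta, zetaP, zetaM, Matrix.trace_fin_two,
      Matrix.mul_apply, Fin.sum_univ_two] <;> ring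

theorem trace_outer_ketP_mul_psi (s : Bool × Bool) :
    (outer ketP * psi s).trace = zeta (s.2 = false) := by
  obtain ⟨t, _ | _⟩ := s <;>
    simp [outer, ketP, psi, sigmaZ, sigmaX, sign, zeta, zetaP, zetaM, Matrix.trace_fin_two,
      Matrix.mul_apply, Fin.sum_univ_two, ofReal_sqrt_two_inv_mul_self] <;> ring

theorem trace_outer_ketM_mul_psi (s : Bool × Bool) :
    (outer ketM * psi s).trace = zeta (s.2 = true) := by
  obtain ⟨t, _ | _⟩ := s <;>
    simp [outer, ketM, psi, sigmaZ, sigmaX, sign, zeta, zetaP, zetaM, Matrix.trace_fin_two,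
      Matrix.mul_apply, Fin.sum_univ_two, ofReal_sqrt_two_inv_mul_self] <;> ring

theorem shift_MAC_probabilities (a : Bool × Bool × Bool) (x y z : Bool × Bool) :
    (outer (shift a) * ((psi x ⊗ₖ psi y) ⊗ₖ psi z)).trace =
      ((zetaP ^ eta a x y z * zetaM ^ (3 - eta a x y z) : ℝ) : ℂ) := by
  obtain ⟨_ | _, _ | _, _ | _⟩ := a <;>
    simp only [shift, trace_outer_tens3_mul, trace_outer_ket0_mul_psi, trace_outer_ket1_mul_psi,
      trace_outer_ketP_mul_psi, trace_outer_ketM_mul_psi, ← Complex.ofReal_mul,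
      zeta_mul_zeta_mul_zeta] <;>
    simp [eta]
end
end

section
/- The witness value of the SHIFT MAC equals 10(5√2 − 6): Σ_{x,y,z ∈ {0,1}²} Σ_{a ∈ {0,1}³} W(a;x,y,z) · ζ₊^{η(a;x,y,z)} ζ₋^{3−η(a;x,y,z)} = 10(5√2 − 6), where W(a;x,y,z) = 2 if η(a;x,y,z)=3, −3 if η=2, −2 if η=1, and −2 if η=0. -/
noncomputable section

/-- The SHIFT witness coefficients. -/
def W (a : Bool × Bool × Bool) (x y z : Bool × Bool) : ℝ :=
  if eta a x y z = 3 then 2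
  else if eta a x y z = 2 then -3
  else if eta a x y z = 1 then -2
  else -2

/-- For each output `a`, the values of `η` over the 64 inputs follow the binomial counts
`8 * (1, 3, 3, 1)`. -/
theorem sum_comp_eta (a : Bool × Bool × Bool) (g : ℕ → ℝ) :
    ∑ x : Bool × Bool, ∑ y : Bool × Bool, ∑ z : Bool × Bool, g (eta a x y z)
      = 8 * g 3 + 24 * g 2 + 24 * g 1 + 8 * g 0 := by
  obtain ⟨_ | _, _ | _, _ | _⟩ := a <;>
  · simp [Fintype.sum_prod_type, eta, ind]
    ring

theorem inv_sqrt_two : (Real.sqrt 2)⁻¹ = Real.sqrt 2 / 2 := by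
  rw [inv_eq_one_div, div_eq_div_iff (by positivity) two_ne_zero, one_mul,
    Real.mul_self_sqrt zero_le_two]

theorem shift_witness_quantum_value :
    (∑ x : Bool × Bool, ∑ y : Bool × Bool, ∑ z : Bool × Bool, ∑ a : Bool × Bool × Bool,
        W a x y z * (zetaP ^ eta a x y z * zetaM ^ (3 - eta a x y z)))
      = 10 * (5 * Real.sqrt 2 - 6) := by
  have swap : ∀ F : Bool × Bool × Bool → Bool × Bool → Bool × Bool → Bool × Bool → ℝ,
      ∑ x, ∑ y, ∑ z, ∑ a, F a x y z = ∑ a, ∑ x, ∑ y, ∑ z, F a x y z := fun F ↦ by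
    simp_rw [Finset.sum_comm (s := (Finset.univ : Finset (Bool × Bool)))
      (t := (Finset.univ : Finset (Bool × Bool × Bool)))]
  let g : ℕ → ℝ := fun n ↦
    (if n = 3 then 2 else if n = 2 then -3 else if n = 1 then -2 else -2)
      * (zetaP ^ n * zetaM ^ (3 - n))
  have hg : ∀ a x y z, W a x y z * (zetaP ^ eta a x y z * zetaM ^ (3 - eta a x y z))
      = g (eta a x y z) := fun _ _ _ _ ↦ rfl
  simp_rw [hg]
  rw [swap fun a x y z ↦ g (eta a x y z)]
  simp_rw [sum_comp_eta]
  have h2 : Real.sqrt 2 ^ 2 = 2 := Real.sq_sqrt zero_le_two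
  have h3 : Real.sqrt 2 ^ 3 = 2 * Real.sqrt 2 := by rw [pow_succ, h2]
  simp [g, zetaP, zetaM, inv_sqrt_two]
  ring_nf
  rw [h2, h3]
  ring
end
end

section
/- The maximum over all classical deterministic strategies of the SHIFT witness payoff equals 8: (i) for all E1,E2,E3 : {0,1}² → {0,1} and D : {0,1}³ → {0,1}³, Σ_{x,y,z ∈ {0,1}²} W(D(E1(x),E2(y),E3(z)); x,y,z) ≤ 8, where W(a;x,y,z) = 2 if η(a;x,y,z)=3, −3 if η=2, −2 if η=1, and −2 if η=0; and (ii) there exists such a strategy achieving payoff exactly 8 (e.g. each sender sends the first bit of its input with a suitable decoding). -/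
noncomputable section

/-- The SHIFT witness payoff of a classical deterministic strategy. -/
def payoff (E1 E2 E3 : Bool × Bool → Bool)
    (D : Bool × Bool × Bool → Bool × Bool × Bool) : ℝ :=
  ∑ x : Bool × Bool, ∑ y : Bool × Bool, ∑ z : Bool × Bool,
    W (D (E1 x, E2 y, E3 z)) x y z

/-- A single-bit test on an input: the first component selects the bit (`false` for the first bit),
the second component is the value it is compared with. -/
abbrev BitTest : Type := Bool × Bool

def BitTest.passes (t : BitTest) (x : Bool × Bool) : Bool :=
  (if t.1 then x.2 else x.1) == t.2

/-- The test that `eta a` applies to the first input. -/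
def test₁ (a : Bool × Bool × Bool) : BitTest :=
  if a.1 = a.2.1 then (if a.2.1 = a.2.2 then (false, a.1) else (false, false))
  else if a.2.2 = a.1 then (false, true) else (true, a.1)

/-- The test that `eta a` applies to the second input. -/
def test₂ (a : Bool × Bool × Bool) : BitTest :=
  if a.1 = a.2.1 then (if a.2.1 = a.2.2 then (false, a.2.1) else (false, true))
  else if a.2.2 = a.1 then (true, a.2.1) else (false, false)

/-- The test that `eta a` applies to the third input. -/
def test₃ (a : Bool × Bool × Bool) : BitTest :=
  if a.1 = a.2.1 then (if a.2.1 = a.2.2 then (false, a.2.2) else (true, a.2.2))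
  else if a.2.2 = a.1 then (false, false) else (false, true)

lemma eta_eq_tests (a : Bool × Bool × Bool) (x y z : Bool × Bool) :
    eta a x y z = ((test₁ a).passes x).toNat + ((test₂ a).passes y).toNat
      + ((test₃ a).passes z).toNat := by
  obtain ⟨a₁, a₂, a₃⟩ := a
  obtain ⟨x₁, x₂⟩ := x
  obtain ⟨y₁, y₂⟩ := y
  obtain ⟨z₁, z₂⟩ := z
  revert a₁ a₂ a₃ x₁ x₂ y₁ y₂ z₁ z₂
  unfold eta ind
  decide +kernel

/-- The value contributed by a block of inputs of sizes `n₁ × n₂ × n₃` when the guess agrees with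
`h₁`, `h₂`, `h₃` of the inputs of the respective senders. -/
def blockValue (n₁ n₂ n₃ h₁ h₂ h₃ : ℤ) : ℤ :=
  7 * (h₁ * h₂ * h₃) - (h₁ * h₂ * n₃ + h₁ * n₂ * h₃ + n₁ * h₂ * h₃) - 2 * (n₁ * n₂ * n₃)

lemma W_eq_blockValue (a : Bool × Bool × Bool) (x y z : Bool × Bool) :
    W a x y z = (blockValue 1 1 1 ((test₁ a).passes x).toNat ((test₂ a).passes y).toNat
      ((test₃ a).passes z).toNat : ℤ) := by
  unfold W
  rw [eta_eq_tests]
  cases (test₁ a).passes x <;> cases (test₂ a).passes y <;> cases (test₃ a).passes z <;>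
    norm_num [blockValue]

/-- The number of inputs encoded by `E` as `b`. -/
def fiberCard (E : Bool × Bool → Bool) (b : Bool) : ℕ :=
  ∑ x : Bool × Bool, (E x == b).toNat

/-- The number of inputs encoded by `E` as `b` that pass the test `t`. -/
def passCard (E : Bool × Bool → Bool) (b : Bool) (t : BitTest) : ℕ :=
  ∑ x : Bool × Bool, (E x == b).toNat * (t.passes x).toNat

lemma sum_blockValue (u v w p q r : Bool × Bool → ℤ) :
    ∑ x, ∑ y, ∑ z, u x * v y * w z * blockValue 1 1 1 (p x) (q y) (r z) =
      blockValue (∑ x, u x) (∑ y, v y) (∑ z, w z)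
        (∑ x, u x * p x) (∑ y, v y * q y) (∑ z, w z * r z) := by
  simp only [blockValue, Fintype.sum_prod_type, Fintype.sum_bool]
  ring

/-- The payoff decomposes over the messages received by the decoder. -/
lemma payoff_eq_sum_blockValue (E₁ E₂ E₃ : Bool × Bool → Bool)
    (D : Bool × Bool × Bool → Bool × Bool × Bool) :
    payoff E₁ E₂ E₃ D = ((∑ b₁ : Bool, ∑ b₂ : Bool, ∑ b₃ : Bool,
      blockValue (fiberCard E₁ b₁) (fiberCard E₂ b₂) (fiberCard E₃ b₃)
        (passCard E₁ b₁ (test₁ (D (b₁, b₂, b₃)))) (passCard E₂ b₂ (test₂ (D (b₁, b₂, b₃))))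
        (passCard E₃ b₃ (test₃ (D (b₁, b₂, b₃)))) : ℤ) : ℝ) := by
  have split (f : Bool → Bool → Bool → ℤ) (c₁ c₂ c₃ : Bool) :
      f c₁ c₂ c₃ = ∑ b₁ : Bool, ∑ b₂ : Bool, ∑ b₃ : Bool,
        ((c₁ == b₁).toNat : ℤ) * (c₂ == b₂).toNat * (c₃ == b₃).toNat * f b₁ b₂ b₃ := by
    cases c₁ <;> cases c₂ <;> cases c₃ <;> simp
  simp only [payoff, W_eq_blockValue, fiberCard, passCard]
  push_cast only [← Int.cast_sum, Int.cast_inj, Nat.cast_sum, Nat.cast_mul]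
  simp only [← sum_blockValue]
  simp_rw [fun x y z => split (fun b₁ b₂ b₃ => blockValue 1 1 1
    ((test₁ (D (b₁, b₂, b₃))).passes x).toNat ((test₂ (D (b₁, b₂, b₃))).passes y).toNat
    ((test₃ (D (b₁, b₂, b₃))).passes z).toNat) (E₁ x) (E₂ y) (E₃ z)]
  simp only [Fintype.sum_bool, Finset.sum_add_distrib]

/-- The numbers of elements of a set of inputs with first bit `0`, first bit `1`, second bit `0`
and second bit `1`. -/
abbrev Profile : Type := ℕ × ℕ × ℕ × ℕ

namespace Profile

def card (P : Profile) : ℕ := P.1 + P.2.1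

def count (P : Profile) (t : BitTest) : ℕ :=
  if t.1 then (if t.2 then P.2.2.2 else P.2.2.1) else (if t.2 then P.2.1 else P.1)

/-- The profile of the complementary set. -/
def compl (P : Profile) : Profile := (2 - P.1, 2 - P.2.1, 2 - P.2.2.1, 2 - P.2.2.2)

/-- The gain over the constant `-2` of a guess agreeing with `h₁`, `h₂`, `h₃` inputs,
truncated at zero. -/
def gain (n₁ n₂ n₃ h₁ h₂ h₃ : ℕ) : ℕ :=
  7 * (h₁ * h₂ * h₃) - (h₁ * h₂ * n₃ + h₁ * n₂ * h₃ + n₁ * h₂ * h₃)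

/-- The largest gain of a guess on a block of inputs. -/
def maxGain (P Q R : Profile) : ℕ :=
  Finset.univ.sup fun a : Bool × Bool × Bool =>
    gain P.card Q.card R.card (P.count (test₁ a)) (Q.count (test₂ a)) (R.count (test₃ a))

lemma gain_le_maxGain (P Q R : Profile) (a : Bool × Bool × Bool) :
    gain P.card Q.card R.card (P.count (test₁ a)) (Q.count (test₂ a)) (R.count (test₃ a))
      ≤ maxGain P Q R :=
  Finset.le_sup (f := fun a : Bool × Bool × Bool =>
    gain P.card Q.card R.card (P.count (test₁ a)) (Q.count (test₂ a)) (R.count (test₃ a)))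
    (Finset.mem_univ a)

/-- The sum of the maximal gains over all blocks of the partitions into sets with profiles
`P`, `Q`, `R` and their complements. -/
def totalGain (P P₁ Q Q₁ R R₁ : Profile) : ℕ :=
  maxGain P Q R + maxGain P Q R₁ + maxGain P Q₁ R + maxGain P Q₁ R₁ +
    (maxGain P₁ Q R + maxGain P₁ Q R₁ + maxGain P₁ Q₁ R + maxGain P₁ Q₁ R₁)

/-- The profiles of sets of inputs, up to complement. -/
def representatives : List Profile :=
  [(0, 0, 0, 0), (1, 0, 1, 0), (1, 0, 0, 1), (0, 1, 1, 0), (0, 1, 0, 1), (2, 0, 1, 1),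
    (1, 1, 2, 0), (1, 1, 1, 1)]

lemma totalGain_representatives_le :
    ∀ P ∈ representatives, ∀ Q ∈ representatives, ∀ R ∈ representatives,
      totalGain P P.compl Q Q.compl R R.compl ≤ 136 := by
  decide +kernel

/-- The profile of the set of inputs encoded by `E` as `b`. -/
def ofFiber (E : Bool × Bool → Bool) (b : Bool) : Profile :=
  (passCard E b (false, false), passCard E b (false, true), passCard E b (true, false),
    passCard E b (true, true))

lemma card_ofFiber (E : Bool × Bool → Bool) (b : Bool) :
    (ofFiber E b).card = fiberCard E b := by
  simp [card, ofFiber, fiberCard, passCard, BitTest.passes, Fintype.sum_prod_type]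
  ring

lemma count_ofFiber (E : Bool × Bool → Bool) (b : Bool) (t : BitTest) :
    (ofFiber E b).count t = passCard E b t := by
  obtain ⟨i, v⟩ := t
  cases i <;> cases v <;> rfl

lemma exists_representative :
    ∀ E : Bool × Bool → Bool, ∃ b, ofFiber E b ∈ representatives ∧
      ofFiber E (!b) = (ofFiber E b).compl := by
  decide +kernel

lemma totalGain_ofFiber_le (E₁ E₂ E₃ : Bool × Bool → Bool) :
    ∑ b₁ : Bool, ∑ b₂ : Bool, ∑ b₃ : Bool,
      maxGain (ofFiber E₁ b₁) (ofFiber E₂ b₂) (ofFiber E₃ b₃) ≤ 136 := by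
  obtain ⟨b₁, hmem₁, hcompl₁⟩ := exists_representative E₁
  obtain ⟨b₂, hmem₂, hcompl₂⟩ := exists_representative E₂
  obtain ⟨b₃, hmem₃, hcompl₃⟩ := exists_representative E₃
  have h := totalGain_representatives_le _ hmem₁ _ hmem₂ _ hmem₃
  rw [← hcompl₁, ← hcompl₂, ← hcompl₃] at h
  simp only [Fintype.sum_bool]
  cases b₁ <;> cases b₂ <;> cases b₃ <;>
    simp only [totalGain, Bool.not_true, Bool.not_false] at h <;>
    linarith

end Profile

open Profile in
lemma blockValue_le_maxGain (E₁ E₂ E₃ : Bool × Bool → Bool) (b₁ b₂ b₃ : Bool)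
    (a : Bool × Bool × Bool) :
    blockValue (fiberCard E₁ b₁) (fiberCard E₂ b₂) (fiberCard E₃ b₃)
        (passCard E₁ b₁ (test₁ a)) (passCard E₂ b₂ (test₂ a)) (passCard E₃ b₃ (test₃ a)) ≤
      maxGain (ofFiber E₁ b₁) (ofFiber E₂ b₂) (ofFiber E₃ b₃) -
        2 * (fiberCard E₁ b₁ * fiberCard E₂ b₂ * fiberCard E₃ b₃) := by
  have h := gain_le_maxGain (ofFiber E₁ b₁) (ofFiber E₂ b₂) (ofFiber E₃ b₃) a
  simp only [card_ofFiber, count_ofFiber, gain, Nat.sub_le_iff_le_add] at h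
  unfold blockValue
  zify at h
  linarith

lemma sum_fiberCard (E : Bool × Bool → Bool) : ∑ b : Bool, (fiberCard E b : ℤ) = 4 := by
  revert E
  decide +kernel

open Profile in
lemma payoff_le_eight (E₁ E₂ E₃ : Bool × Bool → Bool)
    (D : Bool × Bool × Bool → Bool × Bool × Bool) : payoff E₁ E₂ E₃ D ≤ 8 := by
  rw [payoff_eq_sum_blockValue]
  have hgain : (∑ b₁ : Bool, ∑ b₂ : Bool, ∑ b₃ : Bool,
      (maxGain (ofFiber E₁ b₁) (ofFiber E₂ b₂) (ofFiber E₃ b₃) : ℤ)) ≤ 136 := by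
    exact_mod_cast totalGain_ofFiber_le E₁ E₂ E₃
  have hcard : ∑ b₁ : Bool, ∑ b₂ : Bool, ∑ b₃ : Bool,
      2 * ((fiberCard E₁ b₁ : ℤ) * fiberCard E₂ b₂ * fiberCard E₃ b₃) = 128 := by
    simp only [← Finset.mul_sum, ← Finset.sum_mul, sum_fiberCard]
    norm_num
  have hsum := Finset.sum_le_sum fun b₁ (_ : b₁ ∈ Finset.univ) =>
    Finset.sum_le_sum fun b₂ (_ : b₂ ∈ Finset.univ) =>
      Finset.sum_le_sum fun b₃ (_ : b₃ ∈ Finset.univ) =>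
        blockValue_le_maxGain E₁ E₂ E₃ b₁ b₂ b₃ (D (b₁, b₂, b₃))
  simp only [Finset.sum_sub_distrib] at hsum
  exact_mod_cast hsum.trans (by linarith)

/-- An optimal decoder when every sender transmits its first bit. -/
def firstBitDecoder (b : Bool × Bool × Bool) : Bool × Bool × Bool :=
  if b.1 = b.2.1 ∧ b.2.1 = b.2.2 then b
  else if b.1 = false ∧ b.2.1 = true then (false, false, true)
  else if b.1 = true ∧ b.2.2 = false then (false, true, false)
  else (false, true, true)

lemma payoff_firstBitDecoder : payoff Prod.fst Prod.fst Prod.fst firstBitDecoder = 8 := by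
  rw [payoff_eq_sum_blockValue]
  norm_cast

theorem shift_witness_classical_bound :
    (∀ (E1 E2 E3 : Bool × Bool → Bool)
        (D : Bool × Bool × Bool → Bool × Bool × Bool),
      payoff E1 E2 E3 D ≤ 8) ∧
    (∃ (E1 E2 E3 : Bool × Bool → Bool)
        (D : Bool × Bool × Bool → Bool × Bool × Bool),
      payoff E1 E2 E3 D = 8) := by
  exact ⟨payoff_le_eight, Prod.fst, Prod.fst, Prod.fst, firstBitDecoder,
    payoff_firstBitDecoder⟩
end
end

section
/- The SHIFT MAC cannot be simulated by 1-bit communication from each of the three senders even with unlimited globally shared classical randomness: there is no probability mass function q on the finite set of quadruples (E1,E2,E3,D), with E1,E2,E3 : {0,1}² → {0,1} and D : {0,1}³ → {0,1}³, such that for all a ∈ {0,1}³ and x,y,z ∈ {0,1}², Σ_{(E1,E2,E3,D)} q(E1,E2,E3,D)·[a = D(E1(x),E2(y),E3(z))] = ζ₊^{η(a;x,y,z)} ζ₋^{3−η(a;x,y,z)}. -/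
noncomputable section

/-- A classical deterministic strategy for the three-sender MAC:
three 1-bit encodings and a decoding. -/
abbrev Strategy3 : Type :=
  (Bool × Bool → Bool) × (Bool × Bool → Bool) × (Bool × Bool → Bool) ×
    (Bool × Bool × Bool → Bool × Bool × Bool)

/-- The score of the output `c` of the party holding `z` when the senders of `x` and `y` are
expected to have first bits `0` and `1`. -/
def pairScore (x y : Bool) (z : Bool × Bool) (c : Bool) : ℤ :=
  if z.2 = c then if x = false ∧ y = true then 1 else if x = y ∧ x ≠ z.1 then -1 else 0 else 0

/-- Coefficients of a Bell-type inequality satisfied by all classical strategies. -/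
def score (a : Bool × Bool × Bool) (x y z : Bool × Bool) : ℤ :=
  if a.1 = a.2.1 then
    if a.2.1 = a.2.2 then 0 else pairScore x.1 y.1 z a.2.2
  else if a.2.2 = a.1 then pairScore z.1 x.1 y a.2.1
  else pairScore y.1 z.1 x a.1

/-- The positive part of the total `pairScore` against product weights. -/
def gain (u v w : Bool × Bool → ℕ) (c : Bool) : ℕ :=
  (u (false, false) + u (false, true)) * (v (true, false) + v (true, true)) *
      (w (false, c) + w (true, c)) -
    ((u (true, false) + u (true, true)) * (v (true, false) + v (true, true)) * w (false, c) +
      (u (false, false) + u (false, true)) * (v (false, false) + v (false, true)) * w (true, c))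

/-- The largest total score of a constant output against product weights. -/
def cellBound (u v w : Bool × Bool → ℕ) : ℕ :=
  max (max (max (gain u v w false) (gain u v w true))
    (max (gain w u v false) (gain w u v true))) (max (gain v w u false) (gain v w u true))

theorem sum_pairScore_le_gain (u v w : Bool × Bool → ℕ) (c : Bool) :
    ∑ x, ∑ y, ∑ z, (u x * v y * w z : ℤ) * pairScore x.1 y.1 z c ≤ gain u v w c := by
  have h : ∀ m n : ℕ, (m : ℤ) - n ≤ (m - n : ℕ) := fun m n => by omega
  refine le_trans (le_of_eq ?_) (h _ _)
  cases c <;> simp [Fintype.sum_prod_type, pairScore] <;> ring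

theorem sum_score_le_cellBound (u v w : Bool × Bool → ℕ) (a : Bool × Bool × Bool) :
    ∑ x, ∑ y, ∑ z, (u x * v y * w z : ℤ) * score a x y z ≤ cellBound u v w := by
  have huvw := sum_pairScore_le_gain u v w
  have hwuv : ∀ c, ∑ x, ∑ y, ∑ z, (u x * v y * w z : ℤ) * pairScore z.1 x.1 y c ≤
      gain w u v c := fun c => by
    refine le_trans (le_of_eq ?_) (sum_pairScore_le_gain w u v c)
    simp only [Fintype.sum_prod_type, Fintype.sum_bool]
    ring
  have hvwu : ∀ c, ∑ x, ∑ y, ∑ z, (u x * v y * w z : ℤ) * pairScore y.1 z.1 x c ≤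
      gain v w u c := fun c => by
    refine le_trans (le_of_eq ?_) (sum_pairScore_le_gain v w u c)
    simp only [Fintype.sum_prod_type, Fintype.sum_bool]
    ring
  have h0 : (0 : ℤ) ≤ cellBound u v w := Int.natCast_nonneg _
  have := huvw false
  have := huvw true
  have := hwuv false
  have := hwuv true
  have := hvwu false
  have := hvwu true
  obtain ⟨_ | _, _ | _, _ | _⟩ := a <;> simp [score] <;> simp only [cellBound] at * <;> omega

/-- The encoding with the given values on `00`, `01`, `10`, `11`. -/
def table (a b c d : Bool) (x : Bool × Bool) : Bool :=
  bif x.1 then bif x.2 then d else c else bif x.2 then b else a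

/-- The indicator weight of the inputs encoded as `m`. -/
def cell (E : Bool × Bool → Bool) (m : Bool) (x : Bool × Bool) : ℕ := (E x == m).toNat

/-- Up to exchanging the two messages, an encoding sends `false` on the input `(false, false)`. -/
theorem cell_eq_cell_table (E : Bool × Bool → Bool) :
    ∃ b c d, (∀ m, cell E m = cell (table false b c d) m) ∨
      ∀ m, cell E m = cell (table false b c d) !m := by
  cases h : E (false, false)
  · refine ⟨E (false, true), E (true, false), E (true, true), .inl fun m => ?_⟩
    funext ⟨x, y⟩
    cases x <;> cases y <;> simp [cell, table, h]
  · refine ⟨!E (false, true), !E (true, false), !E (true, true), .inr fun m => ?_⟩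
    funext ⟨x, y⟩
    cases m <;> cases x <;> cases y <;> simp [cell, table, h]

/-- The bound on the total score, summed over the eight messages. -/
def totalBound (E₁ E₂ E₃ : Bool × Bool → Bool) : ℕ :=
  cellBound (cell E₁ false) (cell E₂ false) (cell E₃ false) +
  cellBound (cell E₁ false) (cell E₂ false) (cell E₃ true) +
  cellBound (cell E₁ false) (cell E₂ true) (cell E₃ false) +
  cellBound (cell E₁ false) (cell E₂ true) (cell E₃ true) +
  cellBound (cell E₁ true) (cell E₂ false) (cell E₃ false) +
  cellBound (cell E₁ true) (cell E₂ false) (cell E₃ true) +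
  cellBound (cell E₁ true) (cell E₂ true) (cell E₃ false) +
  cellBound (cell E₁ true) (cell E₂ true) (cell E₃ true)

theorem totalBound_table_le : ∀ b₁ c₁ d₁ b₂ c₂ d₂ b₃ c₃ d₃ : Bool,
    totalBound (table false b₁ c₁ d₁) (table false b₂ c₂ d₂) (table false b₃ c₃ d₃) ≤ 24 := by
  decide +kernel

theorem totalBound_le (E₁ E₂ E₃ : Bool × Bool → Bool) : totalBound E₁ E₂ E₃ ≤ 24 := by
  obtain ⟨b₁, c₁, d₁, h₁⟩ := cell_eq_cell_table E₁
  obtain ⟨b₂, c₂, d₂, h₂⟩ := cell_eq_cell_table E₂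
  obtain ⟨b₃, c₃, d₃, h₃⟩ := cell_eq_cell_table E₃
  have h := totalBound_table_le b₁ c₁ d₁ b₂ c₂ d₂ b₃ c₃ d₃
  rcases h₁ with h₁ | h₁ <;> rcases h₂ with h₂ | h₂ <;> rcases h₃ with h₃ | h₃ <;>
    simp only [totalBound, h₁, h₂, h₃, Bool.not_true, Bool.not_false] at h ⊢ <;> omega

theorem sum_score_strategy_le (t : Strategy3) :
    ∑ x, ∑ y, ∑ z, score (t.2.2.2 (t.1 x, t.2.1 y, t.2.2.1 z)) x y z ≤ 24 := by
  obtain ⟨E₁, E₂, E₃, D⟩ := t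
  calc
    _ = ∑ x, ∑ y, ∑ z, ∑ m : Bool × Bool × Bool,
        (cell E₁ m.1 x * cell E₂ m.2.1 y * cell E₃ m.2.2 z : ℤ) * score (D m) x y z := by
      refine Finset.sum_congr rfl fun x _ => Finset.sum_congr rfl fun y _ =>
        Finset.sum_congr rfl fun z _ => ?_
      cases h₁ : E₁ x <;> cases h₂ : E₂ y <;> cases h₃ : E₃ z <;>
        simp [Fintype.sum_prod_type, cell, h₁, h₂, h₃]
    _ = ∑ m : Bool × Bool × Bool, ∑ x, ∑ y, ∑ z,
        (cell E₁ m.1 x * cell E₂ m.2.1 y * cell E₃ m.2.2 z : ℤ) * score (D m) x y z := by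
      simp only [Finset.sum_comm (t := (Finset.univ : Finset (Bool × Bool × Bool)))]
    _ ≤ ∑ m : Bool × Bool × Bool,
        (cellBound (cell E₁ m.1) (cell E₂ m.2.1) (cell E₃ m.2.2) : ℤ) :=
      Finset.sum_le_sum fun m _ => sum_score_le_cellBound _ _ _ _
    _ = (totalBound E₁ E₂ E₃ : ℤ) := by
      simp only [Fintype.sum_prod_type, Fintype.sum_bool, totalBound]
      push_cast
      ring
    _ ≤ 24 := by exact_mod_cast totalBound_le E₁ E₂ E₃

theorem score_eta (a : Bool × Bool × Bool) (x y z : Bool × Bool) :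
    score a x y z = 1 ∧ eta a x y z = 3 ∨ score a x y z = -1 ∧ eta a x y z = 2 ∨
      score a x y z = 0 := by
  revert a x y z
  decide +kernel

theorem score_mul_prob (a : Bool × Bool × Bool) (x y z : Bool × Bool) :
    (score a x y z : ℝ) * (zetaP ^ eta a x y z * zetaM ^ (3 - eta a x y z)) =
      ((if score a x y z = 1 then 1 else 0 : ℕ) : ℝ) * zetaP ^ 3 -
        ((if score a x y z = -1 then 1 else 0 : ℕ) : ℝ) * (zetaP ^ 2 * zetaM) := by
  rcases score_eta a x y z with ⟨h, h'⟩ | ⟨h, h'⟩ | h <;> simp [*]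

theorem sum_score_eq_one :
    ∑ a, ∑ x, ∑ y, ∑ z, (if score a x y z = 1 then 1 else 0 : ℕ) = 48 := by
  decide +kernel

theorem sum_score_eq_neg_one :
    ∑ a, ∑ x, ∑ y, ∑ z, (if score a x y z = -1 then 1 else 0 : ℕ) = 48 := by
  decide +kernel

theorem sum_score_mul_prob :
    ∑ a, ∑ x, ∑ y, ∑ z,
      (score a x y z : ℝ) * (zetaP ^ eta a x y z * zetaM ^ (3 - eta a x y z)) =
        12 + 9 * √2 := by
  simp only [score_mul_prob, Finset.sum_sub_distrib, ← Finset.sum_mul, ← Nat.cast_sum,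
    sum_score_eq_one, sum_score_eq_neg_one]
  have h : (√2)⁻¹ = √2 / 2 := by
    rw [inv_eq_one_div, div_eq_div_iff (by positivity) two_ne_zero]
    simp
  have h2 : √2 ^ 2 = (2 : ℝ) := Real.sq_sqrt zero_le_two
  have h3 : √2 ^ 3 = 2 * √2 := by rw [pow_succ, h2]
  simp only [zetaP, zetaM, h]
  ring_nf
  rw [h2, h3]
  ring

theorem sum_ite_score (t : Strategy3) :
    ∑ a, ∑ x, ∑ y, ∑ z, (score a x y z : ℝ) *
        (if a = t.2.2.2 (t.1 x, t.2.1 y, t.2.2.1 z) then 1 else 0) =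
      ((∑ x, ∑ y, ∑ z, score (t.2.2.2 (t.1 x, t.2.1 y, t.2.2.1 z)) x y z : ℤ) : ℝ) := by
  simp only [Finset.sum_comm (s := (Finset.univ : Finset (Bool × Bool × Bool)))]
  simp

/-- The SHIFT MAC cannot be simulated by 1-bit communication from each of the
three senders, even with unlimited globally shared classical randomness. -/
theorem shift_MAC_not_classically_simulable :
    ¬ ∃ q : Strategy3 → ℝ,
        (∀ t, 0 ≤ q t) ∧ (∑ t, q t = 1) ∧
        ∀ (a : Bool × Bool × Bool) (x y z : Bool × Bool),
          (∑ t, q t * (if a = t.2.2.2 (t.1 x, t.2.1 y, t.2.2.1 z) then 1 else 0)) =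
            zetaP ^ eta a x y z * zetaM ^ (3 - eta a x y z) := by
  rintro ⟨q, hq, hsum, hp⟩
  have hle : 12 + 9 * √2 ≤ (24 : ℝ) := calc
    12 + 9 * √2 = ∑ t, q t * ∑ a, ∑ x, ∑ y, ∑ z, (score a x y z : ℝ) *
        (if a = t.2.2.2 (t.1 x, t.2.1 y, t.2.2.1 z) then 1 else 0) := by
      simp only [← sum_score_mul_prob, ← hp, Finset.mul_sum,
        Finset.sum_comm (s := (Finset.univ : Finset Strategy3)), mul_left_comm]
    _ ≤ ∑ t, q t * 24 := by
      refine Finset.sum_le_sum fun t _ => mul_le_mul_of_nonneg_left ?_ (hq t)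
      rw [sum_ite_score]
      exact_mod_cast sum_score_strategy_le t
    _ = 24 := by rw [← Finset.sum_mul, hsum, one_mul]
  have hlt : (4 / 3 : ℝ) < √2 := Real.lt_sqrt_of_sq_lt (by norm_num)
  linarith
end
end
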